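/- arXiv:1708.03844 — 6 statements merged into one kernel-verified Lean document; each statement's English description precedes it below -/
import Mathlib

section
/- Let G be a finite group and let Θ : G → ℂ be a generalized character of G (a difference of characters of finite-dimensional complex representations of G) which takes exactly N distinct values on G, and suppose Θ(g) ≠ Θ(1) for all g ∈ G with g ≠ 1. Then for every irreducible character χ of G there exists an integer k with 0 ≤ k ≤ N−1 such that [Θ^k, χ]_G ≠ 0, where Θ^k denotes the pointwise k-th power of Θ (with Θ^0 the constant function 1). -/
noncomputable section

/-- The scalar product `[f, h]_G` of two complex-valued class functions on a finite group. -/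
def charInner (G : Type) [Group G] (f h : G → ℂ) : ℂ :=
  (Nat.card G : ℂ)⁻¹ * ∑ᶠ g : G, f g * (starRingEnd ℂ) (h g)

/-- `f` is the character of a finite-dimensional complex representation of `G`. -/
def IsChar (G : Type) [Group G] (f : G → ℂ) : Prop :=
  ∃ V : FDRep ℂ G, f = V.character

/-- `f` is a generalized (virtual) character of `G`, i.e. a difference of two characters. -/
def IsGenChar (G : Type) [Group G] (f : G → ℂ) : Prop :=
  ∃ V W : FDRep ℂ G, f = V.character - W.character

/-- `f` is an irreducible character of `G`. -/
def IsIrrChar (G : Type) [Group G] (f : G → ℂ) : Prop :=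
  ∃ V : FDRep ℂ G, CategoryTheory.Simple V ∧ f = V.character

/-- `f` is a degree-one (linear) character of `G`. -/
def IsLinChar (G : Type) [Group G] (f : G → ℂ) : Prop :=
  IsChar G f ∧ f 1 = 1

/-- The `q`-power map `x ↦ x ^ q` as a ring homomorphism on a finite field of
cardinality `q ^ 2`. -/
def qFrob (q : ℕ) (K : Type) [Field K] [Fintype K] (hK : Fintype.card K = q ^ 2) :
    K →+* K where
  toFun x := x ^ q
  map_one' := one_pow q
  map_mul' x y := mul_pow x y q
  map_zero' := by
    have hq : q ≠ 0 := by
      intro h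
      have hpos : 0 < Fintype.card K := Fintype.card_pos
      rw [hK, h] at hpos
      simp at hpos
    exact zero_pow hq
  map_add' x y := by
    haveI : CharP K (ringChar K) := ringChar.charP K
    obtain ⟨m, hp, hcard⟩ := FiniteField.card K (ringChar K)
    have h2 : q ^ 2 = ringChar K ^ (m : ℕ) := by rw [← hK, hcard]
    have hqdvd : q ∣ ringChar K ^ (m : ℕ) := ⟨q, by rw [← h2]; ring⟩
    obtain ⟨a, -, hqa⟩ := (Nat.dvd_prime_pow hp).mp hqdvd
    haveI : Fact (ringChar K).Prime := ⟨hp⟩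
    rw [hqa]
    exact add_pow_char_pow x y (ringChar K) a

/-- The general unitary group `GU_n(q)`, as a subgroup of the group of invertible
`n × n` matrices over the field with `q ^ 2` elements: the condition is
`(g^{(q)})ᵀ ⬝ g = 1` where `g^{(q)}` applies `x ↦ x^q` entrywise. -/
def GU (n q : ℕ) (K : Type) [Field K] [Fintype K] (hK : Fintype.card K = q ^ 2) :
    Subgroup (Matrix (Fin n) (Fin n) K)ˣ where
  carrier := {g | ((g : Matrix (Fin n) (Fin n) K).map (qFrob q K hK)).transpose *
      (g : Matrix (Fin n) (Fin n) K) = 1}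
  one_mem' := by
    show ((((1 : (Matrix (Fin n) (Fin n) K)ˣ) : Matrix (Fin n) (Fin n) K)).map
        (qFrob q K hK)).transpose * _ = 1
    rw [Units.val_one, Matrix.map_one _ (map_zero _) (map_one _), Matrix.transpose_one, one_mul]
  mul_mem' := by
    intro a b ha hb
    have ha' : (((a : Matrix (Fin n) (Fin n) K)).map (qFrob q K hK)).transpose *
        (a : Matrix (Fin n) (Fin n) K) = 1 := ha
    have hb' : (((b : Matrix (Fin n) (Fin n) K)).map (qFrob q K hK)).transpose *
        (b : Matrix (Fin n) (Fin n) K) = 1 := hb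
    show ((((a * b : (Matrix (Fin n) (Fin n) K)ˣ) : Matrix (Fin n) (Fin n) K)).map
        (qFrob q K hK)).transpose * _ = 1
    rw [Units.val_mul, Matrix.map_mul, Matrix.transpose_mul, mul_assoc,
      ← mul_assoc (((a : Matrix (Fin n) (Fin n) K)).map (qFrob q K hK)).transpose, ha',
      one_mul, hb']
  inv_mem' := by
    intro a ha
    have ha' : (((a : Matrix (Fin n) (Fin n) K)).map (qFrob q K hK)).transpose *
        (a : Matrix (Fin n) (Fin n) K) = 1 := ha
    have hAC : (a : Matrix (Fin n) (Fin n) K) *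
        ((a⁻¹ : (Matrix (Fin n) (Fin n) K)ˣ) : Matrix (Fin n) (Fin n) K) = 1 := a.mul_inv
    have h1 : (((a : Matrix (Fin n) (Fin n) K)).map (qFrob q K hK)) *
        ((((a⁻¹ : (Matrix (Fin n) (Fin n) K)ˣ) : Matrix (Fin n) (Fin n) K)).map
          (qFrob q K hK)) = 1 := by
      rw [← Matrix.map_mul, hAC, Matrix.map_one _ (map_zero _) (map_one _)]
    have h2 : ((((a⁻¹ : (Matrix (Fin n) (Fin n) K)ˣ) : Matrix (Fin n) (Fin n) K)).map
        (qFrob q K hK)).transpose *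
        (((a : Matrix (Fin n) (Fin n) K)).map (qFrob q K hK)).transpose = 1 := by
      have := congrArg Matrix.transpose h1
      rwa [Matrix.transpose_mul, Matrix.transpose_one] at this
    have h3 : ((((a⁻¹ : (Matrix (Fin n) (Fin n) K)ˣ) : Matrix (Fin n) (Fin n) K)).map
        (qFrob q K hK)).transpose = (a : Matrix (Fin n) (Fin n) K) := by
      calc ((((a⁻¹ : (Matrix (Fin n) (Fin n) K)ˣ) : Matrix (Fin n) (Fin n) K)).map
            (qFrob q K hK)).transpose
          = ((((a⁻¹ : (Matrix (Fin n) (Fin n) K)ˣ) : Matrix (Fin n) (Fin n) K)).map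
            (qFrob q K hK)).transpose *
            ((((a : Matrix (Fin n) (Fin n) K)).map (qFrob q K hK)).transpose *
              (a : Matrix (Fin n) (Fin n) K)) := by rw [ha', mul_one]
        _ = (((((a⁻¹ : (Matrix (Fin n) (Fin n) K)ˣ) : Matrix (Fin n) (Fin n) K)).map
            (qFrob q K hK)).transpose *
            (((a : Matrix (Fin n) (Fin n) K)).map (qFrob q K hK)).transpose) *
            (a : Matrix (Fin n) (Fin n) K) := by rw [mul_assoc]
        _ = (a : Matrix (Fin n) (Fin n) K) := by rw [h2, one_mul]
    show ((((a⁻¹ : (Matrix (Fin n) (Fin n) K)ˣ) : Matrix (Fin n) (Fin n) K)).map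
        (qFrob q K hK)).transpose * _ = 1
    rw [h3, hAC]

/-- The subgroup of invertible matrices of determinant `1`. -/
def SLsub (n : ℕ) (K : Type) [Field K] : Subgroup (Matrix (Fin n) (Fin n) K)ˣ where
  carrier := {g | (g : Matrix (Fin n) (Fin n) K).det = 1}
  one_mem' := by
    show ((1 : (Matrix (Fin n) (Fin n) K)ˣ) : Matrix (Fin n) (Fin n) K).det = 1
    rw [Units.val_one, Matrix.det_one]
  mul_mem' := by
    intro a b ha hb
    have ha' : (a : Matrix (Fin n) (Fin n) K).det = 1 := ha
    have hb' : (b : Matrix (Fin n) (Fin n) K).det = 1 := hb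
    show ((a * b : (Matrix (Fin n) (Fin n) K)ˣ) : Matrix (Fin n) (Fin n) K).det = 1
    rw [Units.val_mul, Matrix.det_mul, ha', hb', mul_one]
  inv_mem' := by
    intro a ha
    have ha' : (a : Matrix (Fin n) (Fin n) K).det = 1 := ha
    show ((a⁻¹ : (Matrix (Fin n) (Fin n) K)ˣ) : Matrix (Fin n) (Fin n) K).det = 1
    have h : ((a⁻¹ : (Matrix (Fin n) (Fin n) K)ˣ) : Matrix (Fin n) (Fin n) K).det *
        (a : Matrix (Fin n) (Fin n) K).det = 1 := by
      rw [← Matrix.det_mul, a.inv_mul, Matrix.det_one]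
    rwa [ha', mul_one] at h

/-- `cardExp ε` is `1` for `ε = +` (`true`) and `2` for `ε = −` (`false`): the natural module
of `GL^ε_n(q)` is defined over the field with `q ^ cardExp ε` elements. -/
def cardExp : Bool → ℕ
  | true => 1
  | false => 2

/-- The group `GL^ε_n(q)`: the full general linear group when `ε = +` (`true`), and the
general unitary group `GU_n(q)` when `ε = −` (`false`), as a subgroup of the invertible
`n × n` matrices over the field with `q ^ cardExp ε` elements. -/
def GLe (n q : ℕ) (ε : Bool) (K : Type) [Field K] [Fintype K]
    (hK : Fintype.card K = q ^ cardExp ε) : Subgroup (Matrix (Fin n) (Fin n) K)ˣ :=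
  match ε, hK with
  | true, _ => ⊤
  | false, hK => GU n q K hK

/-- The group `SL^ε_n(q)`: `SL_n(q)` when `ε = +` and `SU_n(q)` when `ε = −`. -/
def SLe (n q : ℕ) (ε : Bool) (K : Type) [Field K] [Fintype K]
    (hK : Fintype.card K = q ^ cardExp ε) : Subgroup (Matrix (Fin n) (Fin n) K)ˣ :=
  SLsub n K ⊓ GLe n q ε K hK

theorem SLe_le_GLe (n q : ℕ) (ε : Bool) (K : Type) [Field K] [Fintype K]
    (hK : Fintype.card K = q ^ cardExp ε) : SLe n q ε K hK ≤ GLe n q ε K hK :=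
  inf_le_right

/-- The sign `ε` as a complex number: `1` for `+` (`true`) and `-1` for `−` (`false`). -/
def esgn : Bool → ℂ
  | true => 1
  | false => -1

/-- The sign `ε` as a real number. -/
def esgnR : Bool → ℝ
  | true => 1
  | false => -1

/-- `dim_K ker (g - 1)`, the dimension of the fixed space of `g` on the natural module. -/
def fixedDim {n : ℕ} {K : Type} [Field K] (g : (Matrix (Fin n) (Fin n) K)ˣ) : ℕ :=
  Module.finrank K
    (LinearMap.ker (Matrix.mulVecLin ((g : Matrix (Fin n) (Fin n) K) - 1)))

/-- The (reducible) Weil character `τ` of `GL^ε_n(q)`: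
`τ(g) = ε^n (ε q)^{dim_{F_Q} ker (g - 1)}`. -/
def weilChar (q : ℕ) (ε : Bool) {n : ℕ} {K : Type} [Field K]
    (g : (Matrix (Fin n) (Fin n) K)ˣ) : ℂ :=
  esgn ε ^ n * (esgn ε * q) ^ fixedDim g

/-- The restriction of the Weil character to a subgroup `H` of the ambient
group of invertible matrices. -/
def weilOn (q : ℕ) (ε : Bool) {n : ℕ} {K : Type} [Field K]
    (H : Subgroup (Matrix (Fin n) (Fin n) K)ˣ) : ↥H → ℂ :=
  fun g => weilChar q ε (g : (Matrix (Fin n) (Fin n) K)ˣ)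

/-- The true level `l*(χ)`: the smallest `j ≥ 0` such that `χ` is a constituent of `τ^j`
(the pointwise `j`-th power of the Weil character). -/
def trueLevel (q : ℕ) (ε : Bool) {n : ℕ} {K : Type} [Field K]
    (H : Subgroup (Matrix (Fin n) (Fin n) K)ˣ) (χ : ↥H → ℂ) : ℕ :=
  sInf {j : ℕ | charInner ↥H (weilOn q ε H ^ j) χ ≠ 0}

/-- The level `l(χ)`: the smallest `j ≥ 0` such that `λ · χ` is a constituent of `τ^j`
for some degree-one character `λ`. -/
def level (q : ℕ) (ε : Bool) {n : ℕ} {K : Type} [Field K]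
    (H : Subgroup (Matrix (Fin n) (Fin n) K)ˣ) (χ : ↥H → ℂ) : ℕ :=
  sInf {j : ℕ | ∃ l : ↥H → ℂ, IsLinChar ↥H l ∧
    charInner ↥H (weilOn q ε H ^ j) (l * χ) ≠ 0}

/-- Restriction of a class function along an inclusion of subgroups. -/
def restrictChar {G : Type} [Group G] {H₁ H₂ : Subgroup G} (h : H₁ ≤ H₂)
    (χ : ↥H₂ → ℂ) : ↥H₁ → ℂ :=
  fun x => χ (Subgroup.inclusion h x)

/-- Two `j`-tuples of vectors are related iff some element of `H` carries one to the other;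
the orbits of `H` on `j`-tuples are the equivalence classes of this relation. -/
def tupleRel {n : ℕ} {K : Type} [Field K] (H : Subgroup (Matrix (Fin n) (Fin n) K)ˣ)
    (j : ℕ) (v w : Fin j → Fin n → K) : Prop :=
  ∃ g ∈ H, ∀ i, Matrix.mulVec (g : Matrix (Fin n) (Fin n) K) (v i) = w i

/-- `δ(g)`: the largest dimension of an eigenspace of `g` on the natural module extended
to the algebraic closure. -/
def maxEigDim {n : ℕ} {K : Type} [Field K] (g : (Matrix (Fin n) (Fin n) K)ˣ) : ℕ :=
  sSup {d : ℕ | ∃ c : AlgebraicClosure K,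
    d = Module.finrank (AlgebraicClosure K)
      (LinearMap.ker (Matrix.mulVecLin
        ((g : Matrix (Fin n) (Fin n) K).map (algebraMap K (AlgebraicClosure K)) - c • 1)))}

end

theorem FDRep.character_one_ne_zero {k G : Type*} [Field k] [CharZero k] [Monoid G]
    (V : FDRep k G) [CategoryTheory.Simple V] : V.character 1 ≠ 0 := by
  rw [FDRep.char_one, Nat.cast_ne_zero]
  intro h
  have : Subsingleton V := Module.finrank_zero_iff.mp h
  refine CategoryTheory.id_nonzero V ?_
  ext v
  exact Subsingleton.elim _ _

/-- A linear combination of the powers of `f`, given by a polynomial `p`, pairs with `h`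
by linearity. -/
theorem charInner_polynomial_eval (G : Type) [Group G] [Finite G] (f h : G → ℂ)
    (p : Polynomial ℂ) :
    charInner G (fun g => p.eval (f g)) h =
      ∑ k ∈ Finset.range (p.natDegree + 1), p.coeff k * charInner G (f ^ k) h := by
  have := Fintype.ofFinite G
  simp only [charInner, finsum_eq_sum_of_fintype, Polynomial.eval_eq_sum_range,
    Pi.pow_apply, Finset.mul_sum, Finset.sum_mul]
  rw [Finset.sum_comm]
  refine Finset.sum_congr rfl fun k _ => Finset.sum_congr rfl fun g _ => ?_
  ring

theorem charInner_of_support (G : Type) [Group G] [Finite G] (f h : G → ℂ)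
    (hf : ∀ g, g ≠ 1 → f g = 0) :
    charInner G f h = (Nat.card G : ℂ)⁻¹ * (f 1 * (starRingEnd ℂ) (h 1)) := by
  rw [charInner, finsum_eq_single _ 1 fun g hg => by rw [hf g hg, zero_mul]]

/-- Lemma on generalized characters, essentially due to Brauer.
If a generalized character `Θ` of a finite group `G` takes exactly `N` distinct values and
`Θ(g) ≠ Θ(1)` for all `g ≠ 1`, then every irreducible character of `G` occurs in some power
`Θ^k` with `0 ≤ k ≤ N - 1`. -/
theorem character_levels_stmt0 (G : Type) [Group G] [Finite G]
    (Θ : G → ℂ) (hΘ : IsGenChar G Θ)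
    (N : ℕ) (hN : (Set.range Θ).ncard = N)
    (hone : ∀ g : G, g ≠ 1 → Θ g ≠ Θ 1)
    (χ : G → ℂ) (hχ : IsIrrChar G χ) :
    ∃ k ≤ N - 1, charInner G (Θ ^ k) χ ≠ 0 := by
  obtain ⟨V, hV, rfl⟩ := hχ
  have hfin : (Set.range Θ).Finite := Set.finite_range Θ
  set S : Finset ℂ := hfin.toFinset.erase (Θ 1) with hS
  have hcard : S.card = N - 1 := by
    rw [hS, Finset.card_erase_of_mem (by simp), ← Set.ncard_eq_toFinset_card _ hfin, hN]
  set p : Polynomial ℂ := ∏ a ∈ S, (Polynomial.X - Polynomial.C a) with hp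
  have hdeg : p.natDegree = N - 1 := by
    rw [hp, Polynomial.natDegree_finsetProd_X_sub_C_eq_card, hcard]
  have hvanish : ∀ g : G, g ≠ 1 → p.eval (Θ g) = 0 := by
    intro g hg
    rw [hp, Polynomial.eval_prod]
    exact Finset.prod_eq_zero (i := Θ g) (by simp [hS, hone g hg]) (by simp)
  have hp1 : p.eval (Θ 1) ≠ 0 := by
    rw [hp, Polynomial.eval_prod, Finset.prod_ne_zero_iff]
    intro a ha
    simpa [sub_eq_zero] using (Finset.ne_of_mem_erase ha).symm
  by_contra! hzero
  have hsum := charInner_polynomial_eval G Θ V.character p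
  rw [charInner_of_support G _ _ hvanish, Finset.sum_eq_zero] at hsum
  · have hG : (Nat.card G : ℂ) ≠ 0 := Nat.cast_ne_zero.mpr Nat.card_pos.ne'
    have hV1 : (starRingEnd ℂ) (V.character 1) ≠ 0 :=
      (map_ne_zero _).mpr V.character_one_ne_zero
    exact mul_ne_zero (inv_ne_zero hG) (mul_ne_zero hp1 hV1) hsum
  · intro k hk
    rw [Finset.mem_range, hdeg] at hk
    rw [hzero k (by omega), mul_zero]
end

section
/- Let q be a prime power and 1 ≤ j ≤ n. Let N_j denote the number of orbits of G acting diagonally on the set of ordered j-tuples (v_1, …, v_j) of vectors of the natural module V. If G = GL_n(q) and V = (F_q)^n, then N_j ≤ 8·q^{j²/4}; if G = GU_n(q) and V = (F_{q²})^n, then N_j ≤ 2·q^{j²}. -/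
section OrbitCounting

open Finset Matrix

theorem prod_one_sub_half_pow_ge (m : ℕ) :
    (9 / 32 : ℝ) ≤ ∏ i ∈ range m, (1 - (1 / 2 : ℝ) ^ (i + 1)) := by
  have key : ∀ k : ℕ, (9 / 32 : ℝ) + 3 / 8 * (1 / 2) ^ (k + 2) ≤
      ∏ i ∈ range (k + 2), (1 - (1 / 2 : ℝ) ^ (i + 1)) := by
    intro k
    induction k with
    | zero => norm_num [prod_range_succ]
    | succ k ih =>
      rw [prod_range_succ]
      have h0 : (0 : ℝ) < (1 / 2) ^ k := by positivity
      have h1 : ((1 : ℝ) / 2) ^ k ≤ 1 := pow_le_one₀ (by norm_num) (by norm_num)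
      have h2 : (0 : ℝ) ≤ 1 - (1 / 2) ^ (k + 2 + 1) := by
        rw [pow_add, pow_add]; linarith
      refine le_trans ?_ (mul_le_mul_of_nonneg_right ih h2)
      simp only [pow_add, pow_one]
      nlinarith
  rcases m with _ | _ | m
  · norm_num
  · norm_num
  · exact le_trans (le_add_of_nonneg_right (by positivity)) (key m)

theorem prod_one_sub_quarter_pow_ge (m : ℕ) :
    (2 / 3 : ℝ) ≤ ∏ i ∈ range m, (1 - (1 / 4 : ℝ) ^ (i + 1)) := by
  have key : ∀ k : ℕ, (2 / 3 : ℝ) + 1 / 3 * (1 / 4) ^ k ≤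
      ∏ i ∈ range k, (1 - (1 / 4 : ℝ) ^ (i + 1)) := by
    intro k
    induction k with
    | zero => norm_num
    | succ k ih =>
      rw [prod_range_succ]
      have h0 : (0 : ℝ) < (1 / 4) ^ k := by positivity
      have h1 : ((1 : ℝ) / 4) ^ k ≤ 1 := pow_le_one₀ (by norm_num) (by norm_num)
      have h2 : (0 : ℝ) ≤ 1 - (1 / 4) ^ (k + 1) := by
        rw [pow_add]; linarith
      refine le_trans ?_ (mul_le_mul_of_nonneg_right ih h2)
      simp only [pow_add, pow_one]
      nlinarith
  exact le_trans (le_add_of_nonneg_right (by positivity)) (key m)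

theorem sum_pow_mul_sub_add_two (q j : ℕ) :
    ∑ m ∈ range (j + 2 + 1), (q : ℝ) ^ (m * (j + 2 - m)) =
      2 + (q : ℝ) ^ (j + 1) * ∑ m ∈ range (j + 1), (q : ℝ) ^ (m * (j - m)) := by
  rw [sum_range_succ, sum_range_succ', mul_sum]
  have : ∀ m ∈ range (j + 1), (q : ℝ) ^ ((m + 1) * (j + 2 - (m + 1))) =
      (q : ℝ) ^ (j + 1) * (q : ℝ) ^ (m * (j - m)) := by
    intro m hm
    obtain ⟨d, rfl⟩ := Nat.exists_eq_add_of_le (Nat.lt_succ_iff.mp (mem_range.mp hm))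
    rw [← pow_add]
    congr 1
    rw [show m + d + 2 - (m + 1) = d + 1 by omega, show m + d - m = d by omega]
    ring
  rw [sum_congr rfl this]
  simp
  ring

theorem sum_pow_mul_sub_le {q : ℕ} (hq : 2 ≤ q) {j : ℕ} (hj : 1 ≤ j) :
    ∑ m ∈ range (j + 1), (q : ℝ) ^ (m * (j - m)) ≤ 9 / 4 * (q : ℝ) ^ ((j : ℝ) ^ 2 / 4) := by
  have hq' : (2 : ℝ) ≤ q := by exact_mod_cast hq
  have hq0 : (0 : ℝ) < q := by linarith
  have hr : (117 / 100 : ℝ) ≤ (q : ℝ) ^ (1 / 4 : ℝ) := by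
    rw [one_div, Real.le_rpow_inv_iff_of_pos (by norm_num) hq0.le (by norm_num)]
    norm_num
    linarith
  have hstep : ∀ k : ℕ, (q : ℝ) ^ (((k + 2 : ℕ) : ℝ) ^ 2 / 4) =
      (q : ℝ) ^ (k + 1) * (q : ℝ) ^ ((k : ℝ) ^ 2 / 4) := by
    intro k
    rw [← Real.rpow_natCast _ (k + 1), ← Real.rpow_add hq0]
    congr 1
    push_cast
    ring
  have key : ∀ k : ℕ, ∑ m ∈ range (k + 2 + 1), (q : ℝ) ^ (m * (k + 2 - m)) + 2 / 7 ≤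
      9 / 4 * (q : ℝ) ^ (((k + 2 : ℕ) : ℝ) ^ 2 / 4) := by
    intro k
    induction k using Nat.twoStepInduction with
    | zero =>
      rw [sum_pow_mul_sub_add_two, hstep]
      norm_num
      linarith
    | one =>
      rw [sum_pow_mul_sub_add_two, hstep]
      norm_num [sum_range_succ]
      norm_num at hr
      nlinarith
    | more k ih _ =>
      rw [sum_pow_mul_sub_add_two, hstep]
      have h8 : (8 : ℝ) ≤ (q : ℝ) ^ (k + 2 + 1) := by
        calc (8 : ℝ) = 2 ^ 3 := by norm_num
          _ ≤ (q : ℝ) ^ 3 := by gcongr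
          _ ≤ _ := pow_le_pow_right₀ (by linarith) (by omega)
      nlinarith [mul_le_mul_of_nonneg_left ih (by linarith : (0 : ℝ) ≤ (q : ℝ) ^ (k + 2 + 1))]
  rcases j with _ | _ | j
  · omega
  · norm_num [sum_range_succ]
    norm_num at hr
    linarith
  · have := key j
    linarith

theorem sum_half_pow_sq_le (j : ℕ) :
    ∑ m ∈ range j, (1 / 2 : ℝ) ^ ((m + 1) ^ 2) ≤ 2 / 3 := by
  have key : ∑ m ∈ range j, (1 / 2 : ℝ) ^ ((m + 1) ^ 2) ≤ 2 / 3 - 2 / 3 * (1 / 4) ^ j := by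
    induction j with
    | zero => simp
    | succ j ih =>
      rw [sum_range_succ]
      have : (1 / 2 : ℝ) ^ ((j + 1) ^ 2) ≤ (1 / 2) ^ (2 * j + 1) :=
        pow_le_pow_of_le_one (by norm_num) (by norm_num) (by nlinarith)
      rw [pow_add, pow_mul] at this
      norm_num at this
      rw [pow_succ (1 / 4 : ℝ) j]
      norm_num at ih ⊢
      linarith
  exact key.trans (sub_le_self _ (by positivity))

theorem card_submodule_finrank_mul_prod_le (K : Type*) {V : Type*} [Field K] [Fintype K]
    [AddCommGroup V] [Module K V] [Finite V] (m : ℕ) :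
    (Nat.card {W : Submodule K V // Module.finrank K W = m} : ℝ) *
      (∏ i ∈ range m, (1 - ((Fintype.card K : ℝ)⁻¹) ^ (i + 1))) *
        (Fintype.card K : ℝ) ^ (m * m) ≤
      (Fintype.card K : ℝ) ^ (Module.finrank K V * m) := by
  classical
  have := Fintype.ofFinite V
  set Q := Fintype.card K with hQ
  have hQ0 : 0 < Q := Fintype.card_pos
  let T := Σ W : {W : Submodule K V // Module.finrank K W = m},
    {s : Fin m → W.1 // LinearIndependent K s}
  let F : T → (Fin m → V) := fun p i => (p.2.1 i : V)
  have hspan : ∀ p : T, Submodule.span K (Set.range (F p)) = p.1.1 := by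
    rintro ⟨⟨W, hW⟩, s, hs⟩
    have h1 : Submodule.span K (Set.range s) = ⊤ :=
      hs.span_eq_top_of_card_eq_finrank' (by simp [hW])
    have h2 : Set.range (fun i => (s i : V)) = W.subtype '' Set.range s := by
      rw [← Set.range_comp]; rfl
    change Submodule.span K (Set.range fun i => (s i : V)) = W
    rw [h2, Submodule.span_image, h1, Submodule.map_subtype_top]
  have hF : Function.Injective F := by
    intro p p' h
    have h1 : p.1 = p'.1 := Subtype.ext (by rw [← hspan p, ← hspan p', h])
    obtain ⟨W, s, hs⟩ := p
    obtain ⟨W', s', hs'⟩ := p'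
    obtain rfl : W = W' := h1
    have : s = s' := funext fun i => Subtype.ext (congrFun h i)
    subst this
    rfl
  have hcard := Nat.card_le_card_of_injective F hF
  have hT : Nat.card T = Nat.card {W : Submodule K V // Module.finrank K W = m} *
      ∏ i : Fin m, (Q ^ m - Q ^ (i : ℕ)) := by
    rw [Nat.card_sigma, Finset.sum_congr rfl (g := fun _ => ∏ i : Fin m, (Q ^ m - Q ^ (i : ℕ)))]
    · simp [Nat.card_eq_fintype_card]
    · rintro ⟨W, hW⟩ -
      rw [card_linearIndependent (K := K) (V := W) (k := m) hW.ge, hW]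
  have hV : Nat.card (Fin m → V) = Q ^ (Module.finrank K V * m) := by
    rw [Nat.card_fun, Module.natCard_eq_pow_finrank (K := K) (V := V), ← pow_mul]
    simp [hQ]
  have hprod : ((∏ i : Fin m, (Q ^ m - Q ^ (i : ℕ)) : ℕ) : ℝ) =
      (∏ i ∈ range m, (1 - ((Q : ℝ)⁻¹) ^ (i + 1))) * (Q : ℝ) ^ (m * m) := by
    rw [Fin.prod_univ_eq_prod_range (fun i => Q ^ m - Q ^ i), ← prod_range_reflect, pow_mul,
      Nat.cast_prod]
    conv_rhs => rw [← card_range m, ← prod_const, card_range, ← prod_mul_distrib]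
    refine prod_congr rfl fun i hi => ?_
    obtain ⟨d, rfl⟩ := Nat.exists_eq_add_of_lt (mem_range.mp hi)
    rw [show i + d + 1 - 1 - i = d by omega,
      Nat.cast_sub (Nat.pow_le_pow_right hQ0 (by omega)), sub_mul, one_mul]
    push_cast
    congr 1
    have : (Q : ℝ) ≠ 0 := by positivity
    rw [show i + d + 1 = (i + 1) + d by ring, pow_add _ (i + 1) d, ← mul_assoc, ← mul_pow,
      inv_mul_cancel₀ this, one_pow, one_mul]
  rw [hT, hV] at hcard
  have := (Nat.cast_le (α := ℝ)).mpr hcard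
  rw [Nat.cast_mul, hprod] at this
  push_cast at this
  rwa [← mul_assoc] at this

theorem natCard_submodule_finrank_le (K : Type*) {V : Type*} [Field K] [Fintype K]
    [AddCommGroup V] [Module K V] [Finite V] (m : ℕ) {x c : ℝ} (hc : 0 < c) (hx : x ≤ 1)
    (hK : (Fintype.card K : ℝ)⁻¹ ≤ x) (hcx : c ≤ ∏ i ∈ range m, (1 - x ^ (i + 1))) :
    (Nat.card {W : Submodule K V // Module.finrank K W = m} : ℝ) ≤
      c⁻¹ * (Fintype.card K : ℝ) ^ (m * (Module.finrank K V - m)) := by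
  have hQ0 : 0 < (Fintype.card K : ℝ) := Nat.cast_pos.mpr Fintype.card_pos
  have hx0 : 0 ≤ x := (by positivity : (0 : ℝ) ≤ (Fintype.card K : ℝ)⁻¹).trans hK
  by_cases hm : m ≤ Module.finrank K V
  · have h := card_submodule_finrank_mul_prod_le K (V := V) m
    have h2 : c ≤ ∏ i ∈ range m, (1 - ((Fintype.card K : ℝ)⁻¹) ^ (i + 1)) := by
      refine hcx.trans (prod_le_prod (fun i _ => sub_nonneg.mpr (pow_le_one₀ hx0 hx))
        fun i _ => ?_)
      gcongr
    obtain ⟨d, hd⟩ := Nat.exists_eq_add_of_le hm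
    rw [hd] at h ⊢
    rw [add_mul, pow_add, mul_comm ((Fintype.card K : ℝ) ^ (m * m))] at h
    have h3 := le_of_mul_le_mul_right h (by positivity)
    rw [Nat.add_sub_cancel_left, inv_mul_eq_div, le_div_iff₀ hc, mul_comm m d]
    exact (mul_le_mul_of_nonneg_left h2 (by positivity)).trans h3
  · have : IsEmpty {W : Submodule K V // Module.finrank K W = m} :=
      ⟨fun W => hm (W.2 ▸ Submodule.finrank_le W.1)⟩
    rw [Nat.card_of_isEmpty, Nat.cast_zero]
    positivity

theorem sum_submodule_finrank (K : Type*) {V : Type*} [Field K]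
    [AddCommGroup V] [Module K V] [Module.Finite K V] [Fintype (Submodule K V)] (f : ℕ → ℝ) :
    ∑ W : Submodule K V, f (Module.finrank K W) = ∑ m ∈ range (Module.finrank K V + 1),
      (Nat.card {W : Submodule K V // Module.finrank K W = m} : ℝ) * f m := by
  classical
  rw [← sum_fiberwise_of_maps_to (t := range (Module.finrank K V + 1))
    (g := fun W : Submodule K V => Module.finrank K W)
    (fun W _ => mem_range.mpr (Nat.lt_succ_of_le (Submodule.finrank_le W)))]
  refine sum_congr rfl fun m _ => ?_
  rw [sum_congr rfl (g := fun _ => f m) (fun W hW => by rw [(mem_filter.mp hW).2]), sum_const,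
    nsmul_eq_mul, Nat.card_eq_fintype_card, Fintype.card_subtype]

/-- Two linear maps inverse to each other modulo `W`, parametrizing the quotient by `W`. -/
theorem Submodule.exists_quotient_coordinates {K V : Type*} [Field K] [AddCommGroup V]
    [Module K V] [Module.Finite K V] (W : Submodule K V) :
    ∃ (P : V →ₗ[K] (Fin (Module.finrank K V - Module.finrank K W) → K))
      (S : (Fin (Module.finrank K V - Module.finrank K W) → K) →ₗ[K] V),
      ∀ x, x - S (P x) ∈ W := by
  obtain ⟨s, hs⟩ := W.mkQ.exists_rightInverse_of_surjective W.range_mkQ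
  have e : (V ⧸ W) ≃ₗ[K] (Fin (Module.finrank K V - Module.finrank K W) → K) :=
    LinearEquiv.ofFinrankEq _ _ (by rw [Submodule.finrank_quotient, Module.finrank_fin_fun])
  refine ⟨e.toLinearMap ∘ₗ W.mkQ, s ∘ₗ e.symm.toLinearMap, fun x => ?_⟩
  have h := LinearMap.congr_fun hs (W.mkQ x)
  rw [← Submodule.Quotient.mk_eq_zero, ← Submodule.mkQ_apply, map_sub, sub_eq_zero]
  simpa using h.symm

/-- Matrices that are Hermitian with respect to the ring endomorphism `σ`. -/
abbrev SigmaHermitian {K : Type*} [Field K] (σ : K →+* K) (k : ℕ) : Type _ :=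
  {A : Matrix (Fin k) (Fin k) K // ∀ a b, σ (A a b) = A b a}

theorem natCard_sigmaHermitian_le {K : Type*} [Field K] [Fintype K] {q : ℕ}
    (hK : Fintype.card K = q ^ 2) (σ : K →+* K) (hσ : ∃ θ, σ θ ≠ θ) (k : ℕ) :
    Nat.card (SigmaHermitian σ k) ≤ q ^ k ^ 2 := by
  classical
  obtain ⟨θ, hθ⟩ := hσ
  let F : SigmaHermitian σ k × SigmaHermitian σ k → Matrix (Fin k) (Fin k) K :=
    fun p => p.1.1 + θ • p.2.1
  have hF : Function.Injective F := by
    rintro ⟨⟨A, hA⟩, B, hB⟩ ⟨⟨A', hA'⟩, B', hB'⟩ h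
    have h1 : ∀ a b, A a b + θ * B a b = A' a b + θ * B' a b := fun a b => by
      simpa [F] using congrFun (congrFun h a) b
    have h2 : ∀ a b, A b a + σ θ * B b a = A' b a + σ θ * B' b a := fun a b => by
      simpa [hA, hA', hB, hB'] using congrArg σ (h1 a b)
    have h3 : ∀ a b, B a b = B' a b := fun a b =>
      mul_left_cancel₀ (sub_ne_zero.mpr hθ) (by linear_combination h2 b a - h1 a b)
    have h4 : ∀ a b, A a b = A' a b := fun a b => by simpa [h3] using h1 a b
    obtain rfl : A = A' := by ext a b; exact h4 a b
    obtain rfl : B = B' := by ext a b; exact h3 a b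
    rfl
  have h := Nat.card_le_card_of_injective F hF
  rw [Nat.card_prod, Matrix, Nat.card_fun, Nat.card_fun] at h
  simp only [Nat.card_eq_fintype_card, Fintype.card_fin, hK] at h
  rw [← Nat.card_eq_fintype_card] at h
  refine Nat.mul_self_le_mul_self_iff.mp (h.trans_eq ?_)
  ring

theorem Submodule.exists_dotProduct_ne_zero {n : ℕ} {K : Type*} [Field K]
    {H : Submodule K (Fin n → K)} {u u' : Fin n → K} (hu : u ∉ H) (hu' : u' ∉ H) :
    ∃ y : Fin n → K, (∀ h ∈ H, y ⬝ᵥ h = 0) ∧ y ⬝ᵥ u ≠ 0 ∧ y ⬝ᵥ u' ≠ 0 := by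
  suffices ∃ φ : (Fin n → K) →ₗ[K] K, (∀ h ∈ H, φ h = 0) ∧ φ u ≠ 0 ∧ φ u' ≠ 0 by
    obtain ⟨φ, hφ⟩ := this
    have hdot : ∀ x, (fun i => φ (Pi.single i 1)) ⬝ᵥ x = φ x := fun x => by
      rw [LinearMap.pi_apply_eq_sum_univ φ x, dotProduct]
      refine Finset.sum_congr rfl fun i _ => ?_
      rw [smul_eq_mul, mul_comm]
      congr 2
      ext k
      simp [Pi.single_apply, eq_comm]
    exact ⟨fun i => φ (Pi.single i 1), by simpa only [hdot] using hφ⟩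
  obtain ⟨φ, hφu, hφ⟩ := Submodule.exists_le_ker_of_notMem hu
  obtain ⟨ψ, hψu, hψ⟩ := Submodule.exists_le_ker_of_notMem hu'
  by_cases h1 : φ u' = 0
  · by_cases h2 : ψ u = 0
    · refine ⟨φ + ψ, fun h hh => ?_, ?_, ?_⟩
      · rw [LinearMap.add_apply, LinearMap.mem_ker.mp (hφ hh), LinearMap.mem_ker.mp (hψ hh),
          add_zero]
      · simpa [h2] using hφu
      · simpa [h1] using hψu
    · exact ⟨ψ, fun h hh => hψ hh, h2, hψu⟩
  · exact ⟨φ, fun h hh => hφ hh, hφu, h1⟩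

/-- Two tuples with the same linear relations and the same values of an `H`-invariant function of
two vectors are in the same orbit of `H`, as soon as `H` can always move one further vector while
fixing a tuple. -/
theorem tupleRel_of_extension {n : ℕ} {K : Type} [Field K] {M : Type*}
    (H : Subgroup (Matrix (Fin n) (Fin n) K)ˣ) (B : (Fin n → K) → (Fin n → K) → M)
    (hB : ∀ g ∈ H, ∀ x y, B ((g : Matrix (Fin n) (Fin n) K) *ᵥ x) (g.1 *ᵥ y) = B x y)
    (hstep : ∀ (j : ℕ) (x : Fin j → Fin n → K) (u u' : Fin n → K),
      u ∉ Submodule.span K (Set.range x) → u' ∉ Submodule.span K (Set.range x) →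
      (∀ i, B (x i) u = B (x i) u') → B u u = B u' u' →
      ∃ g ∈ H, (∀ i, (g : Matrix (Fin n) (Fin n) K) *ᵥ x i = x i) ∧ g.1 *ᵥ u = u')
    (j : ℕ) (v w : Fin j → Fin n → K)
    (hker : ∀ c : Fin j → K, ∑ i, c i • v i = 0 ↔ ∑ i, c i • w i = 0)
    (hvw : ∀ i k, B (v i) (v k) = B (w i) (w k)) : tupleRel H j v w := by
  induction j with
  | zero => exact ⟨1, H.one_mem, fun i => i.elim0⟩
  | succ j ih =>
    obtain ⟨g, hg, hgv⟩ := ih (fun i => v i.castSucc) (fun i => w i.castSucc)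
      (fun c => by simpa [Fin.sum_univ_castSucc] using hker (Fin.snoc c 0))
      (fun i k => hvw _ _)
    replace hgv : ∀ i : Fin j, g.1 *ᵥ v i.castSucc = w i.castSucc := hgv
    have hker' : ∀ (c : Fin j → K) (b : K),
        ∑ i, c i • w i.castSucc + b • (g.1 *ᵥ v (Fin.last j)) = 0 ↔
          ∑ i, c i • w i.castSucc + b • w (Fin.last j) = 0 := by
      intro c b
      have h := hker (Fin.snoc c b)
      simp only [Fin.sum_univ_castSucc, Fin.snoc_castSucc, Fin.snoc_last] at h
      rw [← h]
      have h2 : ∑ i, c i • w i.castSucc + b • (g.1 *ᵥ v (Fin.last j)) =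
          g.1 *ᵥ (∑ i, c i • v i.castSucc + b • v (Fin.last j)) := by
        simp only [mulVec_add, mulVec_smul, ← hgv, mulVec_sum]
      rw [h2]
      refine ⟨fun h0 => ?_, fun h0 => by rw [h0, mulVec_zero]⟩
      simpa [mulVec_mulVec] using congrArg ((g⁻¹).1 *ᵥ ·) h0
    suffices ∃ t ∈ H, (∀ i : Fin j, t.1 *ᵥ w i.castSucc = w i.castSucc) ∧
        t.1 *ᵥ (g.1 *ᵥ v (Fin.last j)) = w (Fin.last j) by
      obtain ⟨t, ht, ht1, ht2⟩ := this
      refine ⟨t * g, H.mul_mem ht hg, fun i => ?_⟩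
      rw [Units.val_mul, ← mulVec_mulVec]
      refine Fin.lastCases ht2 (fun i => ?_) i
      rw [hgv, ht1]
    have hmem : ∀ u, u ∈ Submodule.span K (Set.range fun i : Fin j => w i.castSucc) ↔
        ∃ c : Fin j → K, ∑ i, c i • w i.castSucc + (-1 : K) • u = 0 := fun u => by
      rw [Submodule.mem_span_range_iff_exists_fun]
      simp only [neg_smul, one_smul, add_neg_eq_zero]
    have hiff : g.1 *ᵥ v (Fin.last j) ∈
          Submodule.span K (Set.range fun i : Fin j => w i.castSucc) ↔
        w (Fin.last j) ∈ Submodule.span K (Set.range fun i : Fin j => w i.castSucc) := by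
      rw [hmem, hmem]
      exact exists_congr fun c => hker' c (-1)
    by_cases hu : w (Fin.last j) ∈ Submodule.span K (Set.range fun i : Fin j => w i.castSucc)
    · refine ⟨1, H.one_mem, fun i => one_mulVec _, ?_⟩
      obtain ⟨c, hc⟩ := (hmem _).mp hu
      have hc' := (hker' c (-1)).mpr hc
      rw [← hc] at hc'
      simpa using hc'
    · refine hstep j _ _ _ (hiff.not.mpr hu) hu (fun i => ?_) ?_
      · rw [← hgv, hB g hg, hvw, hgv]
      · rw [hB g hg, hvw]

theorem exists_unit_mulVec_eq {n : ℕ} {K : Type*} [Field K] {H : Submodule K (Fin n → K)}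
    {u u' : Fin n → K} (hu : u ∉ H) (hu' : u' ∉ H) :
    ∃ g : (Matrix (Fin n) (Fin n) K)ˣ, (∀ h ∈ H, g.1 *ᵥ h = h) ∧ g.1 *ᵥ u = u' := by
  obtain ⟨y, hy, hyu, hyu'⟩ := Submodule.exists_dotProduct_ne_zero hu hu'
  have hact : ∀ (d z x : Fin n → K), (1 + vecMulVec d z) *ᵥ x = x + (z ⬝ᵥ x) • d := fun d z x => by
    rw [add_mulVec, one_mulVec, vecMulVec_mulVec, op_smul_eq_smul]
  have hinv : (1 + vecMulVec (u' - u) ((y ⬝ᵥ u)⁻¹ • y)) *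
      (1 + vecMulVec (u - u') ((y ⬝ᵥ u')⁻¹ • y)) = 1 := by
    refine Matrix.ext_of_mulVec_single fun i => ?_
    rw [← mulVec_mulVec, hact, hact, one_mulVec]
    generalize (Pi.single i 1 : Fin n → K) = x
    simp only [smul_dotProduct, dotProduct_add, dotProduct_smul, dotProduct_sub, smul_eq_mul]
    ext k
    simp only [Pi.add_apply, Pi.smul_apply, Pi.sub_apply, smul_eq_mul]
    field_simp
    ring
  refine ⟨⟨_, _, hinv, mul_eq_one_comm.mp hinv⟩, fun h hh => ?_, ?_⟩
  · change (1 + vecMulVec _ _) *ᵥ h = h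
    rw [hact, smul_dotProduct, hy h hh, smul_zero, zero_smul, add_zero]
  · change (1 + vecMulVec _ _) *ᵥ u = u'
    rw [hact, smul_dotProduct, smul_eq_mul, inv_mul_cancel₀ hyu, one_smul, add_sub_cancel]

/-- The sesquilinear form `∑ σ(xᵢ) yᵢ`. -/
def sesqForm {n : ℕ} {K : Type*} [Field K] (σ : K →+* K) (x y : Fin n → K) : K :=
  (σ ∘ x) ⬝ᵥ y

section sesqForm

variable {n : ℕ} {K : Type*} [Field K] {σ : K →+* K}

theorem sesqForm_add_left (x x' y : Fin n → K) :
    sesqForm σ (x + x') y = sesqForm σ x y + sesqForm σ x' y := by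
  simp [sesqForm, dotProduct, add_mul, Finset.sum_add_distrib]

theorem sesqForm_sub_left (x x' y : Fin n → K) :
    sesqForm σ (x - x') y = sesqForm σ x y - sesqForm σ x' y := by
  simp [sesqForm, dotProduct, sub_mul, Finset.sum_sub_distrib]

theorem sesqForm_smul_left (a : K) (x y : Fin n → K) :
    sesqForm σ (a • x) y = σ a * sesqForm σ x y := by
  simp [sesqForm, dotProduct, Finset.mul_sum, mul_assoc]

theorem sesqForm_sum_smul_left {ι : Type*} [Fintype ι] (a : ι → K) (x : ι → Fin n → K)
    (y : Fin n → K) : sesqForm σ (∑ i, a i • x i) y = ∑ i, σ (a i) * sesqForm σ (x i) y := by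
  let φ : (Fin n → K) →+ K := AddMonoidHom.mk' (sesqForm σ · y) fun _ _ => sesqForm_add_left _ _ _
  refine (map_sum φ _ _).trans (Finset.sum_congr rfl fun i _ => sesqForm_smul_left _ _ _)

theorem sesqForm_add_right (x y y' : Fin n → K) :
    sesqForm σ x (y + y') = sesqForm σ x y + sesqForm σ x y' :=
  dotProduct_add _ _ _

theorem sesqForm_sub_right (x y y' : Fin n → K) :
    sesqForm σ x (y - y') = sesqForm σ x y - sesqForm σ x y' :=
  dotProduct_sub _ _ _

theorem sesqForm_smul_right (a : K) (x y : Fin n → K) :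
    sesqForm σ x (a • y) = a * sesqForm σ x y :=
  dotProduct_smul _ _ _

theorem sesqForm_sum_smul_right {ι : Type*} [Fintype ι] (a : ι → K) (x : Fin n → K)
    (y : ι → Fin n → K) : sesqForm σ x (∑ i, a i • y i) = ∑ i, a i * sesqForm σ x (y i) := by
  simp [sesqForm, dotProduct_sum]

theorem map_sesqForm (hσ : ∀ a, σ (σ a) = a) (x y : Fin n → K) :
    σ (sesqForm σ x y) = sesqForm σ y x := by
  simp [sesqForm, dotProduct, hσ, mul_comm]

theorem sesqForm_mulVec_mulVec {g : Matrix (Fin n) (Fin n) K} (hg : (g.map σ)ᵀ * g = 1)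
    (x y : Fin n → K) : sesqForm σ (g *ᵥ x) (g *ᵥ y) = sesqForm σ x y := by
  have h : σ ∘ (g *ᵥ x) = (g.map σ) *ᵥ (σ ∘ x) := by
    ext i
    simp [mulVec, dotProduct]
  rw [sesqForm, h, ← vecMul_transpose, dotProduct_mulVec, vecMul_vecMul, hg, vecMul_one, sesqForm]

/-- A reflection or transvection moving `u` to `u'` and fixing every vector orthogonal to
`u - u'`. -/
theorem exists_unitary_of_sesqForm_sub_ne_zero (hσ : ∀ a, σ (σ a) = a) {u u' : Fin n → K}
    (huu : sesqForm σ u u = sesqForm σ u' u') (hne : sesqForm σ (u - u') u ≠ 0) :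
    ∃ g : (Matrix (Fin n) (Fin n) K)ˣ, (g.1.map σ)ᵀ * g.1 = 1 ∧
      (∀ x, sesqForm σ (u - u') x = 0 → g.1 *ᵥ x = x) ∧ g.1 *ᵥ u = u' := by
  set w := u - u' with hw
  set a := -(sesqForm σ w u)⁻¹ with ha
  set R := vecMulVec w (σ ∘ w) with hR
  have hRT : (R.map σ)ᵀ = R := by
    ext i k
    simp [hR, vecMulVec_apply, hσ, mul_comm]
  have hRR : R * R = sesqForm σ w w • R := by
    rw [hR, vecMulVec_mul_vecMulVec]
    ext i k
    simp [sesqForm, vecMulVec_apply]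
    ring
  have haa : a + σ a + σ a * a * sesqForm σ w w = 0 := by
    have h1 : sesqForm σ w w = sesqForm σ w u + σ (sesqForm σ w u) := by
      rw [map_sesqForm hσ, hw]
      simp only [sesqForm_sub_left, sesqForm_sub_right]
      linear_combination -huu
    have h2 : σ (sesqForm σ w u) ≠ 0 := (map_ne_zero σ).mpr hne
    rw [h1, ha, map_neg, map_inv₀]
    field_simp
    ring
  have hM : ((1 + a • R).map σ)ᵀ = 1 + σ a • R := by
    conv_rhs => rw [← hRT]
    ext i k
    by_cases h : i = k <;> simp [h, eq_comm]
  have hmul : ((1 + a • R).map σ)ᵀ * (1 + a • R) = 1 := by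
    rw [hM, add_mul, mul_add, mul_add, one_mul, one_mul, mul_one, smul_mul_smul_comm, hRR,
      smul_smul, add_assoc, ← add_smul, ← add_smul]
    have : a + (σ a + σ a * a * sesqForm σ w w) = 0 := by rw [← add_assoc, haa]
    rw [this, zero_smul, add_zero]
  have hact : ∀ x, (1 + a • R) *ᵥ x = x + (a * sesqForm σ w x) • w := fun x => by
    rw [add_mulVec, one_mulVec, smul_mulVec, hR, vecMulVec_mulVec, op_smul_eq_smul, smul_smul]
    rfl
  refine ⟨⟨1 + a • R, _, mul_eq_one_comm.mp hmul, hmul⟩, hmul, fun x hx => ?_, ?_⟩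
  · change (1 + a • R) *ᵥ x = x
    rw [hact, hx, mul_zero, zero_smul, add_zero]
  · change (1 + a • R) *ᵥ u = u'
    rw [hact, ha, neg_mul, inv_mul_cancel₀ hne, neg_one_smul, hw]
    abel

theorem exists_ne_zero_mul_add_map_eq (hσ : ∀ a, σ (σ a) = a) (hne : ∃ θ, σ θ ≠ θ) {b s : K}
    (hb : b ≠ 0) (hs : σ s = s) : ∃ c, c ≠ 0 ∧ c * b + σ (c * b) = s := by
  suffices ∃ d, d ≠ 0 ∧ d + σ d = s by
    obtain ⟨d, hd, hds⟩ := this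
    exact ⟨d / b, div_ne_zero hd hb, by rwa [div_mul_cancel₀ _ hb]⟩
  obtain ⟨θ, hθ⟩ := hne
  by_cases h0 : s = 0
  · exact ⟨θ - σ θ, sub_ne_zero.mpr hθ.symm, by rw [map_sub, hσ, h0]; ring⟩
  · obtain ⟨y, hy⟩ : ∃ y, y + σ y ≠ 0 := by
      by_contra! h
      have h1 := h 1
      have h2 := h θ
      rw [map_one] at h1
      exact hθ (by linear_combination h2 - θ * h1)
    refine ⟨s * y / (y + σ y), ?_, ?_⟩
    · refine div_ne_zero (mul_ne_zero h0 ?_) hy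
      rintro rfl
      simp at hy
    · rw [map_div₀, map_mul, map_add, hσ, hs, add_comm (σ y)]
      field_simp

/-- The one-vector extension step of Witt's theorem. -/
theorem exists_unitary_mulVec_eq (hσ : ∀ a, σ (σ a) = a) (hne : ∃ θ, σ θ ≠ θ)
    {H : Submodule K (Fin n → K)} {u u' : Fin n → K} (hu : u ∉ H) (hu' : u' ∉ H)
    (hH : ∀ h ∈ H, sesqForm σ u h = sesqForm σ u' h)
    (huu : sesqForm σ u u = sesqForm σ u' u') :
    ∃ g : (Matrix (Fin n) (Fin n) K)ˣ, (g.1.map σ)ᵀ * g.1 = 1 ∧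
      (∀ h ∈ H, g.1 *ᵥ h = h) ∧ g.1 *ᵥ u = u' := by
  by_cases hw : sesqForm σ (u - u') u = 0
  · obtain ⟨y, hy, hyu, hyu'⟩ := Submodule.exists_dotProduct_ne_zero hu hu'
    have hty : ∀ x, sesqForm σ (σ ∘ y) x = y ⬝ᵥ x := fun x => by
      rw [sesqForm]
      congr 1
      ext i
      exact hσ _
    set t := σ ∘ y with ht
    simp only [← hty] at hy hyu hyu'
    obtain ⟨c, hc, hcs⟩ := exists_ne_zero_mul_add_map_eq hσ hne hyu
      (s := -sesqForm σ t t) (by rw [map_neg, map_sesqForm hσ])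
    -- `z = u + c⁻¹ t` is an intermediate image of `u`
    have hcσ : σ c ≠ 0 := (map_ne_zero σ).mpr hc
    have hz : sesqForm σ (u + c⁻¹ • t) (u + c⁻¹ • t) = sesqForm σ u u := by
      simp only [sesqForm_add_left, sesqForm_add_right, sesqForm_smul_left, sesqForm_smul_right,
        map_inv₀]
      rw [map_mul, map_sesqForm hσ] at hcs
      field_simp
      linear_combination hcs
    have huz : sesqForm σ (u - (u + c⁻¹ • t)) u ≠ 0 := by
      rw [sub_add_cancel_left, ← neg_smul, sesqForm_smul_left]
      refine mul_ne_zero ((map_ne_zero σ).mpr (neg_ne_zero.mpr (inv_ne_zero hc))) hyu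
    obtain ⟨g, hg, hgH, hgu⟩ := exists_unitary_of_sesqForm_sub_ne_zero hσ hz.symm huz
    have hzu' : sesqForm σ (u + c⁻¹ • t - u') (u + c⁻¹ • t) ≠ 0 := by
      have h : sesqForm σ (u + c⁻¹ • t - u') (u + c⁻¹ • t) =
          -(c⁻¹ * σ (sesqForm σ t u')) := by
        rw [sesqForm_sub_left, hz, map_sesqForm hσ, sesqForm_add_right, sesqForm_smul_right]
        rw [sesqForm_sub_left] at hw
        linear_combination hw
      rw [h]
      exact neg_ne_zero.mpr (mul_ne_zero (inv_ne_zero hc) ((map_ne_zero σ).mpr hyu'))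
    obtain ⟨k, hk, hkH, hkz⟩ :=
      exists_unitary_of_sesqForm_sub_ne_zero hσ (hz.trans huu) hzu'
    refine ⟨k * g, ?_, fun h hh => ?_, ?_⟩
    · rw [Units.val_mul, Matrix.map_mul, transpose_mul, mul_assoc, ← mul_assoc _ k.1, hk, one_mul,
        hg]
    · rw [Units.val_mul, ← mulVec_mulVec, hgH, hkH]
      · rw [sesqForm_sub_left, sesqForm_add_left, sesqForm_smul_left, hy h hh, hH h hh]
        ring
      · rw [sub_add_cancel_left, ← neg_smul, sesqForm_smul_left, hy h hh, mul_zero]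
    · rw [Units.val_mul, ← mulVec_mulVec, hgu, hkz]
  · obtain ⟨g, hg, hgH, hgu⟩ := exists_unitary_of_sesqForm_sub_ne_zero hσ huu hw
    refine ⟨g, hg, fun h hh => hgH h ?_, hgu⟩
    rw [sesqForm_sub_left, hH h hh, sub_self]

end sesqForm

theorem natCard_quot_le {α β : Type*} [Finite β] (r : α → α → Prop) (f : α → β)
    (hf : ∀ x y, f x = f y → r x y) : Nat.card (Quot r) ≤ Nat.card β := by
  refine Nat.card_le_card_of_injective (fun x : Quot r => f x.out) fun x y h => ?_
  rw [← x.out_eq, ← y.out_eq]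
  exact Quot.sound (hf _ _ h)

theorem ker_linearCombination_eq_iff {K V ι : Type*} [Field K] [AddCommGroup V] [Module K V]
    [Fintype ι] {v w : ι → V} :
    LinearMap.ker (Fintype.linearCombination K v) =
        LinearMap.ker (Fintype.linearCombination K w) ↔
      ∀ c : ι → K, ∑ i, c i • v i = 0 ↔ ∑ i, c i • w i = 0 := by
  simp [SetLike.ext_iff, Fintype.linearCombination_apply]

theorem tupleRel_top_of_ker_eq {n j : ℕ} {K : Type} [Field K] {v w : Fin j → Fin n → K}
    (h : LinearMap.ker (Fintype.linearCombination K v) =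
      LinearMap.ker (Fintype.linearCombination K w)) : tupleRel ⊤ j v w := by
  refine tupleRel_of_extension ⊤ (fun _ _ => ()) (fun _ _ _ _ => rfl) ?_ j v w
    (ker_linearCombination_eq_iff.mp h) (fun _ _ => rfl)
  intro j x u u' hu hu' _ _
  obtain ⟨g, hg, hgu⟩ := exists_unit_mulVec_eq hu hu'
  exact ⟨g, Subgroup.mem_top g, fun i => hg _ (Submodule.subset_span ⟨i, rfl⟩), hgu⟩

theorem natCard_quot_tupleRel_top_le (n j : ℕ) (K : Type) [Field K] [Finite K] :
    Nat.card (Quot (tupleRel (⊤ : Subgroup (Matrix (Fin n) (Fin n) K)ˣ) j)) ≤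
      Nat.card (Submodule K (Fin j → K)) :=
  natCard_quot_le _ (fun v => LinearMap.ker (Fintype.linearCombination K v))
    fun _ _ => tupleRel_top_of_ker_eq

section Unitary

variable {n j q : ℕ} {K : Type} [Field K] [Fintype K] (hK : Fintype.card K = q ^ 2)

theorem two_le_of_card_eq_sq (hK : Fintype.card K = q ^ 2) : 2 ≤ q := by
  have h := Fintype.one_lt_card (α := K)
  rw [hK] at h
  by_contra! hq
  interval_cases q <;> simp at h

theorem qFrob_qFrob (a : K) : qFrob q K hK (qFrob q K hK a) = a := by
  change (a ^ q) ^ q = a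
  rw [← pow_mul, ← sq, ← hK, FiniteField.pow_card]

theorem exists_qFrob_ne : ∃ θ, qFrob q K hK θ ≠ θ := by
  by_contra! h
  have hq := two_le_of_card_eq_sq hK
  have h1 : ∀ x : Kˣ, x ^ (q - 1) = 1 := fun x => by
    have hx : (x : K) ^ q = x := h x
    refine Units.ext (mul_right_cancel₀ x.ne_zero ?_)
    rw [Units.val_pow_eq_pow_val, ← pow_succ, Nat.sub_add_cancel (by omega), hx, Units.val_one,
      one_mul]
  have h2 := Nat.le_of_dvd (by omega) ((FiniteField.forall_pow_eq_one_iff K _).mp h1)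
  rw [hK] at h2
  have : q * 2 ≤ q ^ 2 := by nlinarith
  omega

theorem tupleRel_GU {v w : Fin j → Fin n → K}
    (hker : LinearMap.ker (Fintype.linearCombination K v) =
      LinearMap.ker (Fintype.linearCombination K w))
    (hvw : ∀ i k, sesqForm (qFrob q K hK) (v i) (v k) = sesqForm (qFrob q K hK) (w i) (w k)) :
    tupleRel (GU n q K hK) j v w := by
  refine tupleRel_of_extension _ (sesqForm (qFrob q K hK))
    (fun g hg => sesqForm_mulVec_mulVec hg) ?_ j v w (ker_linearCombination_eq_iff.mp hker) hvw
  intro j x u u' hu hu' hx huu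
  have hspan : ∀ h ∈ Submodule.span K (Set.range x),
      sesqForm (qFrob q K hK) u h = sesqForm (qFrob q K hK) u' h := by
    intro h hh
    induction hh using Submodule.span_induction with
    | mem y hy =>
      obtain ⟨i, rfl⟩ := hy
      rw [← map_sesqForm (qFrob_qFrob hK), hx, map_sesqForm (qFrob_qFrob hK)]
    | zero => simp [sesqForm]
    | add y z _ _ hy hz => rw [sesqForm_add_right, sesqForm_add_right, hy, hz]
    | smul a y _ hy => rw [sesqForm_smul_right, sesqForm_smul_right, hy]
  obtain ⟨g, hg, hgx, hgu⟩ :=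
    exists_unitary_mulVec_eq (qFrob_qFrob hK) (exists_qFrob_ne hK) hu hu' hspan huu
  exact ⟨g, hg, fun i => hgx _ (Submodule.subset_span ⟨i, rfl⟩), hgu⟩

/-- The Gram matrix of a tuple of vectors with respect to coordinates modulo `W`. -/
noncomputable def quotientGram (W : Submodule K (Fin j → K)) (v : Fin j → Fin n → K) :
    SigmaHermitian (qFrob q K hK) (Module.finrank K (Fin j → K) - Module.finrank K W) :=
  ⟨Matrix.of fun a b => sesqForm (qFrob q K hK)
      (Fintype.linearCombination K v
        (W.exists_quotient_coordinates.choose_spec.choose (Pi.single a 1)))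
      (Fintype.linearCombination K v
        (W.exists_quotient_coordinates.choose_spec.choose (Pi.single b 1))),
    fun _ _ => map_sesqForm (qFrob_qFrob hK) _ _⟩

theorem sesqForm_eq_of_quotientGram_eq {W : Submodule K (Fin j → K)} {v w : Fin j → Fin n → K}
    (hv : LinearMap.ker (Fintype.linearCombination K v) = W)
    (hw : LinearMap.ker (Fintype.linearCombination K w) = W)
    (h : quotientGram hK W v = quotientGram hK W w) (i k : Fin j) :
    sesqForm (qFrob q K hK) (v i) (v k) = sesqForm (qFrob q K hK) (w i) (w k) := by
  set P := W.exists_quotient_coordinates.choose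
  set S := W.exists_quotient_coordinates.choose_spec.choose
  have hPS : ∀ x, x - S (P x) ∈ W := W.exists_quotient_coordinates.choose_spec.choose_spec
  have hexp : ∀ u : Fin j → Fin n → K, LinearMap.ker (Fintype.linearCombination K u) = W →
      ∀ i, u i = ∑ a, P (Pi.single i 1) a •
        Fintype.linearCombination K u (S (Pi.single a 1)) := by
    intro u hu i
    have h1 := hu.ge (hPS (Pi.single i 1))
    rw [LinearMap.mem_ker, map_sub, sub_eq_zero, Fintype.linearCombination_apply_single,
      one_smul] at h1
    rw [h1]
    conv_lhs => rw [pi_eq_sum_univ' (P (Pi.single i 1))]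
    rw [map_sum, map_sum]
    refine Finset.sum_congr rfl fun a _ => ?_
    rw [map_smul, map_smul]
  rw [hexp v hv i, hexp v hv k, hexp w hw i, hexp w hw k]
  simp only [sesqForm_sum_smul_left, sesqForm_sum_smul_right]
  refine Finset.sum_congr rfl fun a _ => ?_
  congr 1
  refine Finset.sum_congr rfl fun b _ => ?_
  congr 1
  exact congrFun (congrFun (congrArg Subtype.val h) b) a

theorem natCard_quot_tupleRel_GU_le [Fintype (Submodule K (Fin j → K))] :
    Nat.card (Quot (tupleRel (GU n q K hK) j)) ≤
      ∑ W : Submodule K (Fin j → K), q ^ (j - Module.finrank K W) ^ 2 := by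
  refine (natCard_quot_le (β := Σ W : Submodule K (Fin j → K),
    SigmaHermitian (qFrob q K hK) (Module.finrank K (Fin j → K) - Module.finrank K W)) _
    (fun v => ⟨LinearMap.ker (Fintype.linearCombination K v), quotientGram hK _ v⟩) ?_).trans ?_
  · intro v w h
    obtain ⟨hker, hgram⟩ := Sigma.mk.inj_iff.mp h
    refine tupleRel_GU hK hker (sesqForm_eq_of_quotientGram_eq hK hker rfl ?_)
    rw [hker] at hgram
    exact eq_of_heq hgram
  · rw [Nat.card_sigma]
    refine Finset.sum_le_sum fun W _ => ?_
    refine (natCard_sigmaHermitian_le hK _ (exists_qFrob_ne hK) _).trans_eq ?_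
    rw [Module.finrank_fin_fun]

theorem natCard_quot_tupleRel_GU_le_two_mul :
    (Nat.card (Quot (tupleRel (GU n q K hK) j)) : ℝ) ≤ 2 * (q : ℝ) ^ j ^ 2 := by
  have := Fintype.ofFinite (Submodule K (Fin j → K))
  have hq : (2 : ℝ) ≤ q := by exact_mod_cast two_le_of_card_eq_sq hK
  have hKR : (Fintype.card K : ℝ) = (q : ℝ) ^ 2 := by rw [hK]; push_cast; rfl
  have hKinv : (Fintype.card K : ℝ)⁻¹ ≤ 1 / 4 := by
    rw [hKR, ← one_div]
    exact one_div_le_one_div_of_le (by norm_num) (by nlinarith)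
  have hmain := (Nat.cast_le (α := ℝ)).mpr (natCard_quot_tupleRel_GU_le (n := n) (j := j) hK)
  push_cast at hmain
  refine hmain.trans ?_
  rw [sum_submodule_finrank K fun m => (q : ℝ) ^ (j - m) ^ 2, Module.finrank_fin_fun,
    sum_range_succ']
  have hexp : ∀ m ≤ j, (q : ℝ) ^ (2 * (m * (j - m))) * (q : ℝ) ^ (j - m) ^ 2 =
      (q : ℝ) ^ j ^ 2 * ((q : ℝ)⁻¹) ^ m ^ 2 := by
    intro m hm
    obtain ⟨d, rfl⟩ := Nat.exists_eq_add_of_le hm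
    rw [Nat.add_sub_cancel_left, inv_pow, eq_mul_inv_iff_mul_eq₀ (by positivity), ← pow_add,
      ← pow_add]
    congr 1
    ring
  have hzero : (Nat.card {W : Submodule K (Fin j → K) // Module.finrank K W = 0} : ℝ) *
      (q : ℝ) ^ (j - 0) ^ 2 ≤ (q : ℝ) ^ j ^ 2 := by
    have h := natCard_submodule_finrank_le K (V := Fin j → K) 0 one_pos (by norm_num) hKinv
      (by simp)
    simp only [inv_one, zero_mul, pow_zero, mul_one] at h
    exact mul_le_of_le_one_left (by positivity) h
  have hterm : ∀ m ∈ range j,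
      (Nat.card {W : Submodule K (Fin j → K) // Module.finrank K W = m + 1} : ℝ) *
        (q : ℝ) ^ (j - (m + 1)) ^ 2 ≤
      3 / 2 * (q : ℝ) ^ j ^ 2 * (1 / 2) ^ (m + 1) ^ 2 := by
    intro m hm
    have h := natCard_submodule_finrank_le K (V := Fin j → K) (m + 1) (by norm_num) (by norm_num)
      hKinv (prod_one_sub_quarter_pow_ge (m + 1))
    rw [Module.finrank_fin_fun, hKR, ← pow_mul] at h
    refine (mul_le_mul_of_nonneg_right h (by positivity)).trans ?_
    rw [mul_assoc, hexp (m + 1) (mem_range.mp hm), mul_assoc]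
    norm_num only
    gcongr
    rw [inv_le_comm₀ (by positivity) (by norm_num)]
    simpa using hq
  refine (add_le_add (sum_le_sum hterm) hzero).trans ?_
  rw [← mul_sum]
  have := mul_le_mul_of_nonneg_left (sum_half_pow_sq_le j)
    (by positivity : 0 ≤ 3 / 2 * (q : ℝ) ^ j ^ 2)
  linarith

end Unitary

theorem natCard_submodule_fin_fun_le {q j : ℕ} (hj : 1 ≤ j) (K : Type*) [Field K] [Fintype K]
    (hK : Fintype.card K = q) :
    (Nat.card (Submodule K (Fin j → K)) : ℝ) ≤ 8 * (q : ℝ) ^ ((j : ℝ) ^ 2 / 4) := by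
  have := Fintype.ofFinite (Submodule K (Fin j → K))
  have hq : 2 ≤ q := hK ▸ Fintype.one_lt_card (α := K)
  have hKinv : (Fintype.card K : ℝ)⁻¹ ≤ 1 / 2 := by
    rw [hK, ← one_div]
    exact one_div_le_one_div_of_le (by norm_num) (by exact_mod_cast hq)
  have hsum := sum_submodule_finrank K (V := Fin j → K) fun _ => 1
  simp only [sum_const, card_univ, nsmul_eq_mul, mul_one, Module.finrank_fin_fun] at hsum
  rw [Nat.card_eq_fintype_card, hsum]
  have hterm : ∀ m ∈ range (j + 1),
      (Nat.card {W : Submodule K (Fin j → K) // Module.finrank K W = m} : ℝ) ≤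
        (9 / 32)⁻¹ * (q : ℝ) ^ (m * (j - m)) := by
    intro m _
    have h := natCard_submodule_finrank_le K (V := Fin j → K) m (by norm_num) (by norm_num)
      hKinv (prod_one_sub_half_pow_ge m)
    rwa [Module.finrank_fin_fun, hK] at h
  refine (sum_le_sum hterm).trans ?_
  rw [← mul_sum]
  linarith [sum_pow_mul_sub_le hq hj]

end OrbitCounting

/-- Lemma on the number of orbits on tuples of vectors.
The number of orbits of `GL^ε_n(q)` on ordered `j`-tuples of vectors of the natural module
is at most `8 q^{j²/4}` in the linear case and at most `2 q^{j²}` in the unitary case. -/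
theorem character_levels_stmt2 (n q j : ℕ) (hj1 : 1 ≤ j) (hjn : j ≤ n)
    (ε : Bool) (K : Type) [Field K] [Fintype K]
    (hK : Fintype.card K = q ^ cardExp ε) :
    (Nat.card (Quot (tupleRel (GLe n q ε K hK) j)) : ℝ) ≤
      if ε then 8 * (q : ℝ) ^ ((j : ℝ) ^ 2 / 4) else 2 * (q : ℝ) ^ (j ^ 2 : ℕ) := by
  cases ε with
  | true =>
    rw [if_pos rfl]
    refine le_trans ?_ (natCard_submodule_fin_fun_le hj1 K (hK.trans (pow_one q)))
    exact_mod_cast natCard_quot_tupleRel_top_le n j K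
  | false =>
    rw [if_neg Bool.false_ne_true]
    exact natCard_quot_tupleRel_GU_le_two_mul hK
end

section
/- Let q be a prime power, n ≥ 2, ε = ±, and G = GL^ε_n(q). Then every irreducible character χ of G occurs as a constituent of τ^k (the pointwise k-th power of the Weil character τ) for some integer 0 ≤ k ≤ n. -/
theorem FDRep.finrank_ne_zero_of_simple {G : Type} [Group G] (V : FDRep ℂ G)
    [CategoryTheory.Simple V] : Module.finrank ℂ V ≠ 0 := by
  intro h
  have hs : Subsingleton V := Module.finrank_zero_iff.mp h
  refine CategoryTheory.id_nonzero V ?_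
  ext x
  exact Subsingleton.elim (α := V) _ _

theorem IsIrrChar.apply_one_ne_zero {G : Type} [Group G] {χ : G → ℂ} (hχ : IsIrrChar G χ) :
    χ 1 ≠ 0 := by
  obtain ⟨V, hV, rfl⟩ := hχ
  rw [FDRep.char_one]
  exact_mod_cast FDRep.finrank_ne_zero_of_simple V

theorem fixedDim_le {n : ℕ} {K : Type} [Field K] (g : (Matrix (Fin n) (Fin n) K)ˣ) :
    fixedDim g ≤ n :=
  (Submodule.finrank_le _).trans_eq (Module.finrank_fin_fun K)

theorem fixedDim_eq_iff {n : ℕ} {K : Type} [Field K] (g : (Matrix (Fin n) (Fin n) K)ˣ) :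
    fixedDim g = n ↔ g = 1 := by
  constructor
  · intro h
    have htop : LinearMap.ker (Matrix.mulVecLin ((g : Matrix (Fin n) (Fin n) K) - 1)) = ⊤ :=
      Submodule.eq_top_of_finrank_eq (by rw [← fixedDim, h, Module.finrank_fin_fun])
    have hz : (g : Matrix (Fin n) (Fin n) K) - 1 = 0 :=
      Matrix.toLin'.injective (by
        rw [map_zero, Matrix.toLin'_apply', LinearMap.ker_eq_top.mp htop])
    exact Units.ext (by simpa using sub_eq_zero.mp hz)
  · rintro rfl
    rw [fixedDim, Units.val_one, sub_self, Matrix.mulVecLin_zero, LinearMap.ker_zero, finrank_top,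
      Module.finrank_fin_fun]

/-- The Burnside-Brauer argument: a function `f` on `G` that is separated from its value at `1` by a
polynomial `p` has every `χ` with `χ 1 ≠ 0` non-orthogonal to some power of `f` of exponent at
most `p.natDegree`. -/
theorem exists_charInner_pow_ne_zero {G : Type} [Group G] [Finite G] (f χ : G → ℂ)
    (hχ : χ 1 ≠ 0) (p : Polynomial ℂ) (h1 : p.eval (f 1) ≠ 0)
    (hp : ∀ g, g ≠ 1 → p.eval (f g) = 0) :
    ∃ k ≤ p.natDegree, charInner G (f ^ k) χ ≠ 0 := by
  have := Fintype.ofFinite G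
  by_contra! h
  have hsum : ∀ k ≤ p.natDegree, ∑ g : G, f g ^ k * (starRingEnd ℂ) (χ g) = 0 := by
    intro k hk
    have hk' := h k hk
    rw [charInner, finsum_eq_sum_of_fintype, mul_eq_zero] at hk'
    refine hk'.resolve_left (inv_ne_zero ?_)
    exact_mod_cast Nat.card_pos.ne'
  have hzero : ∑ g : G, p.eval (f g) * (starRingEnd ℂ) (χ g) = 0 := by
    simp only [Polynomial.eval_eq_sum_range, Finset.sum_mul]
    rw [Finset.sum_comm]
    refine Finset.sum_eq_zero fun k hk => ?_
    simp only [mul_assoc, ← Finset.mul_sum]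
    rw [hsum k (Nat.lt_succ_iff.mp (Finset.mem_range.mp hk)), mul_zero]
  rw [Finset.sum_eq_single 1 (fun g _ hg => by rw [hp g hg, zero_mul])
    (fun h => absurd (Finset.mem_univ _) h)] at hzero
  exact mul_ne_zero h1 ((map_ne_zero _).mpr hχ) hzero

theorem esgn_mul_pow_injective (ε : Bool) {q : ℕ} (hq : 2 ≤ q) :
    Function.Injective fun i : ℕ => (esgn ε * q : ℂ) ^ i := by
  intro i j h
  have hnorm := congrArg norm h
  have he : ‖esgn ε‖ = 1 := by cases ε <;> simp [esgn]
  simp only [norm_pow, norm_mul, he, one_mul, Complex.norm_natCast] at hnorm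
  exact Nat.pow_right_injective hq (by exact_mod_cast hnorm)

/-- every irreducible character of `GL^ε_n(q)` occurs in `τ^k` for some
`0 ≤ k ≤ n`. -/
theorem character_levels_stmt3 (n q : ℕ) (hn : 2 ≤ n) (ε : Bool)
    (K : Type) [Field K] [Fintype K] (hK : Fintype.card K = q ^ cardExp ε)
    (χ : ↥(GLe n q ε K hK) → ℂ) (hχ : IsIrrChar _ χ) :
    ∃ k ≤ n, charInner ↥(GLe n q ε K hK) (weilOn q ε (GLe n q ε K hK) ^ k) χ ≠ 0 := by
  have hq : 2 ≤ q := by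
    have hcard : 1 < q ^ cardExp ε := hK ▸ Fintype.one_lt_card
    by_contra! hlt
    exact hcard.not_ge (pow_le_one₀ (Nat.zero_le q) (Nat.lt_succ_iff.mp hlt))
  have he : esgn ε ^ n ≠ 0 := pow_ne_zero _ (by cases ε <;> simp [esgn])
  let p : Polynomial ℂ := ∏ i ∈ Finset.range n,
    (Polynomial.X - Polynomial.C (esgn ε ^ n * (esgn ε * q) ^ i))
  have hdeg : p.natDegree = n := by
    rw [Polynomial.natDegree_finsetProd_X_sub_C_eq_card, Finset.card_range]
  have key := exists_charInner_pow_ne_zero (weilOn q ε (GLe n q ε K hK)) χ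
    hχ.apply_one_ne_zero p ?_ ?_
  · rwa [hdeg] at key
  · simp only [p, Polynomial.eval_prod, Polynomial.eval_sub, Polynomial.eval_X,
      Polynomial.eval_C, weilOn, weilChar, OneMemClass.coe_one, (fixedDim_eq_iff _).mpr rfl]
    refine Finset.prod_ne_zero_iff.mpr fun i hi => sub_ne_zero.mpr fun h => ?_
    exact (Finset.mem_range.mp hi).ne' (esgn_mul_pow_injective ε hq (mul_left_cancel₀ he h))
  · intro g hg
    simp only [p, Polynomial.eval_prod, Polynomial.eval_sub, Polynomial.eval_X,
      Polynomial.eval_C, weilOn, weilChar]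
    refine Finset.prod_eq_zero (i := fixedDim (g : (Matrix (Fin n) (Fin n) K)ˣ)) ?_ (sub_self _)
    refine Finset.mem_range.mpr (lt_of_le_of_ne (fixedDim_le _) fun h => hg ?_)
    exact Subtype.ext ((fixedDim_eq_iff _).mp h)
end

section
/- Let F be a field, and let A and B be finite-dimensional F-vector spaces with dim_F A = n ≥ 1 and dim_F B = j ≥ 1; set V = A ⊗_F B. Let g ∈ GL(A) with δ_A(g) = k. Then: (i) d_V(g ⊗ s) ≤ k·j for all s ∈ GL(B); (ii) if k ≥ n/2, then there is at most one element s ∈ GL(B) with d_V(g ⊗ s) > k(j−2) + n; (iii) if g is not a scalar multiple of the identity and j ≥ 2, then d_V(g ⊗ s) ≤ (n−1)·j for all s ∈ GL(B), and there is at most one element s ∈ GL(B) with d_V(g ⊗ s) > (n−1)(j−1) + 1. -/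
noncomputable section

/-- `d_V(f) = dim_F ker (f - 1)`, the dimension of the fixed space of an endomorphism. -/
def endFixDim (F : Type) [Field F] {V : Type} [AddCommGroup V] [Module F V]
    (f : V →ₗ[F] V) : ℕ :=
  Module.finrank F (LinearMap.ker (f - LinearMap.id))

/-- `δ_V(f)`: the largest dimension of an eigenspace of `f` on `V ⊗_F F̄`, where `F̄` is an
algebraic closure of `F`. -/
def maxEigDimV (F : Type) [Field F] {V : Type} [AddCommGroup V] [Module F V]
    (f : V →ₗ[F] V) : ℕ :=
  sSup {d : ℕ | ∃ c : AlgebraicClosure F,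
    d = Module.finrank (AlgebraicClosure F)
      (LinearMap.ker (LinearMap.baseChange (AlgebraicClosure F) f - c • LinearMap.id))}

end

section FixedSpaces

open TensorProduct Module Polynomial

section Intertwiners

variable {F A C : Type*} [Field F] [AddCommGroup A] [Module F A] [AddCommGroup C] [Module F C]

lemma Submodule.finrank_le_finrank_add_finrank_inf_ker [FiniteDimensional F A]
    [FiniteDimensional F C] (e : A →ₗ[F] C) (S : Submodule F A) (T : Submodule F C)
    (hST : ∀ x ∈ S, e x ∈ T) :
    finrank F S ≤ finrank F T + finrank F ↥(S ⊓ LinearMap.ker e) := by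
  rw [← (e.restrict hST).finrank_range_add_finrank_ker]
  refine add_le_add (Submodule.finrank_le _) ?_
  rw [← finrank_map_subtype_eq]
  refine Submodule.finrank_mono ?_
  rintro _ ⟨y, hy, rfl⟩
  refine ⟨y.2, ?_⟩
  simpa [Subtype.ext_iff] using hy

lemma LinearMap.finrank_ker_mul_le [FiniteDimensional F A] (f g : Module.End F A) :
    finrank F (ker (f * g)) ≤ finrank F (ker f) + finrank F (ker g) := by
  refine (Submodule.finrank_le_finrank_add_finrank_inf_ker g _ (ker f) ?_).trans
    (Nat.add_le_add_left (Submodule.finrank_mono inf_le_right) _)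
  intro x hx
  simpa using hx

/-- The linear maps `φ` with `φ ∘ f = h ∘ φ`. -/
def intertwiners (f : C →ₗ[F] C) (h : A →ₗ[F] A) : Submodule F (C →ₗ[F] A) where
  carrier := {φ | φ ∘ₗ f = h ∘ₗ φ}
  zero_mem' := by simp
  add_mem' {φ ψ} hφ hψ := by
    simp only [Set.mem_ofPred_eq] at *
    rw [LinearMap.add_comp, LinearMap.comp_add, hφ, hψ]
  smul_mem' a φ hφ := by
    simp only [Set.mem_ofPred_eq] at *
    rw [LinearMap.smul_comp, LinearMap.comp_smul, hφ]

lemma intertwiners_apply_pow {f : Module.End F C} {h : Module.End F A} {φ : C →ₗ[F] A}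
    (hφ : φ ∈ intertwiners f h) (i : ℕ) (c : C) : φ ((f ^ i) c) = (h ^ i) (φ c) := by
  induction i with
  | zero => simp
  | succ i ih =>
    have := LinearMap.congr_fun hφ ((f ^ i) c)
    simp only [LinearMap.comp_apply] at this
    rw [pow_succ', pow_succ', Module.End.mul_apply, Module.End.mul_apply, this, ih]

lemma intertwiners_apply_aeval {f : Module.End F C} {h : Module.End F A} {φ : C →ₗ[F] A}
    (hφ : φ ∈ intertwiners f h) (p : F[X]) (c : C) : φ (aeval f p c) = aeval h p (φ c) := by
  simp [aeval_eq_sum_range, LinearMap.sum_apply, intertwiners_apply_pow hφ]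

/-- The smallest `f`-invariant subspace containing `c`. -/
def cyclicSpan (f : Module.End F C) (c : C) : Submodule F C :=
  Submodule.span F (Set.range fun i : ℕ => (f ^ i) c)

lemma pow_mem_cyclicSpan (f : Module.End F C) (c : C) (i : ℕ) : (f ^ i) c ∈ cyclicSpan f c :=
  Submodule.subset_span ⟨i, rfl⟩

lemma cyclicSpan_le_comap (f : Module.End F C) (c : C) :
    cyclicSpan f c ≤ (cyclicSpan f c).comap f := by
  refine Submodule.span_le.2 ?_
  rintro _ ⟨i, rfl⟩
  have := pow_mem_cyclicSpan f c (i + 1)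
  rwa [pow_succ', Module.End.mul_apply] at this

lemma finrank_intertwiners_le_add [FiniteDimensional F A] [FiniteDimensional F C]
    (f : Module.End F C) (h : Module.End F A) (c : C) (W : Submodule F A)
    (hW : ∀ φ ∈ intertwiners f h, φ c ∈ W) :
    finrank F (intertwiners f h) ≤ finrank F W +
      finrank F (intertwiners ((cyclicSpan f c).mapQ _ f (cyclicSpan_le_comap f c)) h) := by
  refine (Submodule.finrank_le_finrank_add_finrank_inf_ker
    (LinearMap.applyₗ c) (intertwiners f h) W hW).trans (Nat.add_le_add_left ?_ _)
  refine (Submodule.finrank_mono (t := (intertwiners ((cyclicSpan f c).mapQ _ f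
    (cyclicSpan_le_comap f c)) h).map (LinearMap.lcomp F A (cyclicSpan f c).mkQ)) ?_).trans
    (Submodule.finrank_map_le _ _)
  rintro φ ⟨hφ, hc⟩
  have hc : φ c = 0 := hc
  have hle : cyclicSpan f c ≤ LinearMap.ker φ := by
    refine Submodule.span_le.2 ?_
    rintro _ ⟨i, rfl⟩
    simp [intertwiners_apply_pow hφ, hc]
  refine ⟨(cyclicSpan f c).liftQ φ hle, ?_, ?_⟩
  · refine Submodule.linearMap_qext _ ?_
    ext x
    simpa using LinearMap.congr_fun hφ x
  · ext x
    simp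

lemma finrank_intertwiners_le [FiniteDimensional F A] (h : Module.End F A) (k : ℕ)
    (hk : ∀ p : F[X], p.Monic → finrank F (LinearMap.ker (aeval h p)) ≤ p.natDegree * k)
    [FiniteDimensional F C] (f : Module.End F C) :
    finrank F (intertwiners f h) ≤ k * finrank F C := by
  induction hN : finrank F C using Nat.strong_induction_on generalizing C with
  | _ N ih =>
    subst hN
    rcases subsingleton_or_nontrivial C with hC | hC
    · simp [finrank_zero_of_subsingleton]
    obtain ⟨c, hc⟩ := exists_ne (0 : C)
    let P := cyclicSpan f c
    let fP : Module.End F P := f.restrict (cyclicSpan_le_comap f c)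
    have hcP : c ∈ P := by simpa using pow_mem_cyclicSpan f c 0
    have hpow : ∀ (i : ℕ) (x : P), (((fP ^ i) x : P) : C) = (f ^ i) x := by
      intro i x
      exact intertwiners_apply_pow (f := fP) (h := f) (φ := P.subtype) rfl i x
    have hann : aeval f fP.charpoly c = 0 := by
      have h1 := intertwiners_apply_aeval (f := fP) (h := f) (φ := P.subtype) rfl fP.charpoly
        ⟨c, hcP⟩
      rw [LinearMap.aeval_self_charpoly] at h1
      simpa using h1.symm
    have hdim : finrank F (C ⧸ P) + finrank F P = finrank F C := P.finrank_quotient_add_finrank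
    have hpos : 0 < finrank F P := by
      have : Nontrivial P := ⟨⟨c, hcP⟩, 0, fun h0 => hc (congrArg Subtype.val h0)⟩
      exact finrank_pos
    have h1 := finrank_intertwiners_le_add f h c (LinearMap.ker (aeval h fP.charpoly)) (by
      intro φ hφ
      rw [LinearMap.mem_ker, ← intertwiners_apply_aeval hφ, hann, map_zero])
    have h2 := hk fP.charpoly fP.charpoly_monic
    rw [LinearMap.charpoly_natDegree] at h2
    have h3 := ih (finrank F (C ⧸ P)) (by omega)
      (P.mapQ P f (cyclicSpan_le_comap f c)) rfl
    rw [← hdim]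
    change _ ≤ _ + finrank F (intertwiners (P.mapQ P f _) h) at h1
    linarith

lemma finrank_intertwiners_le_of_linearIndependent [FiniteDimensional F A] (h : Module.End F A)
    (k : ℕ)
    (hk : ∀ p : F[X], p.Monic → finrank F (LinearMap.ker (aeval h p)) ≤ p.natDegree * k)
    [FiniteDimensional F C] (f : Module.End F C) (c : C)
    (hc : LinearIndependent F ![c, f c]) :
    (finrank F (intertwiners f h) : ℤ) ≤ k * ((finrank F C : ℤ) - 2) + finrank F A := by
  let P := cyclicSpan f c
  have hdim : finrank F (C ⧸ P) + finrank F P = finrank F C := P.finrank_quotient_add_finrank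
  have h2 : 2 ≤ finrank F P := by
    have hspan := finrank_span_eq_card hc
    rw [Fintype.card_fin] at hspan
    refine hspan.symm.le.trans ?_
    refine Submodule.finrank_mono (Submodule.span_le.2 ?_)
    rintro _ ⟨i, rfl⟩
    fin_cases i
    · simpa using pow_mem_cyclicSpan f c 0
    · simpa using pow_mem_cyclicSpan f c 1
  have h1 := finrank_intertwiners_le_add f h c ⊤ (fun _ _ => trivial)
  rw [finrank_top] at h1
  have h3 := finrank_intertwiners_le h k hk (P.mapQ P f (cyclicSpan_le_comap f c))
  have h4 : k * finrank F (C ⧸ P) + 2 * k ≤ k * finrank F C := by nlinarith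
  change _ ≤ _ + finrank F (intertwiners (P.mapQ P f _) h) at h1
  zify at *
  linarith

lemma finrank_intertwiners_smul_id_le [FiniteDimensional F A] [FiniteDimensional F C]
    (h : Module.End F A) (a : F) :
    finrank F (intertwiners (a • (LinearMap.id : C →ₗ[F] C)) h) ≤
      finrank F (LinearMap.ker (h - a • LinearMap.id)) * finrank F C := by
  rw [mul_comm, ← finrank_linearMap F F]
  refine (Submodule.finrank_mono (t := LinearMap.range (LinearMap.compRight F
    (LinearMap.ker (h - a • LinearMap.id)).subtype : (C →ₗ[F] _) →ₗ[F] _)) ?_).trans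
    (LinearMap.finrank_range_le _)
  intro φ hφ
  refine ⟨φ.codRestrict _ fun c => ?_, rfl⟩
  have := LinearMap.congr_fun hφ c
  simp only [LinearMap.comp_apply, LinearMap.smul_apply, LinearMap.id_apply, map_smul] at this
  simp [this]

end Intertwiners

section BaseChange

variable {F A : Type*} [Field F] [AddCommGroup A] [Module F A] [FiniteDimensional F A]

lemma finrank_ker_le_finrank_ker_baseChange (K : Type*) [Field K] [Algebra F K]
    (f : A →ₗ[F] A) :
    finrank F (LinearMap.ker f) ≤ finrank K (LinearMap.ker (f.baseChange K)) := by
  rw [← finrank_baseChange (R := K) (S := F)]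
  let ι := (LinearMap.ker f).subtype.baseChange K
  have hι : Function.Injective ι :=
    Module.Flat.lTensor_preserves_injective_linearMap _ (LinearMap.ker f).injective_subtype
  have hmem : ∀ x, ι x ∈ LinearMap.ker (f.baseChange K) := by
    intro x
    rw [LinearMap.mem_ker, ← LinearMap.comp_apply, ← LinearMap.baseChange_comp]
    have : f ∘ₗ (LinearMap.ker f).subtype = 0 := by ext x; simp
    simp [this]
  exact LinearMap.finrank_le_finrank_of_injective (f := ι.codRestrict _ hmem)
    (fun x y hxy => hι (congrArg Subtype.val hxy))

lemma finrank_ker_aeval_prod_le (h : Module.End F A) (k : ℕ)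
    (hk : ∀ c : F, finrank F (LinearMap.ker (h - c • LinearMap.id)) ≤ k) (s : Multiset F) :
    finrank F (LinearMap.ker (aeval h (s.map fun a => X - C a).prod)) ≤ s.card * k := by
  induction s using Multiset.induction_on with
  | empty =>
    rw [Multiset.map_zero, Multiset.prod_zero, map_one, Module.End.one_eq_id, LinearMap.ker_id,
      finrank_bot]
    exact Nat.zero_le _
  | cons a s ih =>
    rw [Multiset.map_cons, Multiset.prod_cons, map_mul, Multiset.card_cons, add_mul, one_mul,
      add_comm]
    refine (LinearMap.finrank_ker_mul_le _ _).trans (add_le_add ?_ ih)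
    have : aeval h (X - C a) = h - a • LinearMap.id := by
      simp [algebraMap_end_eq_smul_id]
    rw [this]
    exact hk a

lemma finrank_ker_aeval_le (K : Type*) [Field K] [Algebra F K] [IsAlgClosed K]
    (h : Module.End F A) (k : ℕ)
    (hk : ∀ c : K, finrank K (LinearMap.ker (h.baseChange K - c • LinearMap.id)) ≤ k)
    (p : F[X]) (hp : p.Monic) :
    finrank F (LinearMap.ker (aeval h p)) ≤ p.natDegree * k := by
  refine (finrank_ker_le_finrank_ker_baseChange K _).trans ?_
  have hbc : (aeval h p).baseChange K = aeval (h.baseChange K) (p.map (algebraMap F K)) := by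
    rw [aeval_map_algebraMap]
    exact (aeval_algHom_apply (Module.End.baseChangeHom F K A) h p).symm
  have hs : (p.map (algebraMap F K)).Splits := IsAlgClosed.splits _
  rw [hbc, ← hp.natDegree_map (algebraMap F K), hs.natDegree_eq_card_roots]
  conv_lhs => rw [hs.eq_prod_roots_of_monic (hp.map _)]
  exact finrank_ker_aeval_prod_le _ k hk _

lemma finrank_ker_sub_smul_add_le (h : Module.End F A) {a b : F} (hab : a ≠ b) :
    finrank F (LinearMap.ker (h - a • LinearMap.id)) +
      finrank F (LinearMap.ker (h - b • LinearMap.id)) ≤ finrank F A := by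
  refine Submodule.finrank_add_finrank_le_of_disjoint ?_
  rw [Submodule.disjoint_def]
  intro x hx hy
  simp only [LinearMap.mem_ker, LinearMap.sub_apply, LinearMap.smul_apply, LinearMap.id_apply,
    sub_eq_zero] at hx hy
  have : (a - b) • x = 0 := by rw [sub_smul, ← hx, ← hy, sub_self]
  exact (smul_eq_zero.1 this).resolve_left (sub_ne_zero.2 hab)

lemma baseChange_ne_smul_id (K : Type*) [Field K] [Algebra F K] (h : Module.End F A)
    (hns : ∀ c : F, h ≠ c • LinearMap.id) (c : K) : h.baseChange K ≠ c • LinearMap.id := by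
  intro hc
  have : ¬ ∀ v, ¬ LinearIndependent F ![v, h v] := fun hall => by
    obtain ⟨a, ha⟩ := h.exists_eq_smul_id_of_forall_notLinearIndependent hall
    exact hns a ha
  push Not at this
  obtain ⟨v, hv⟩ := this
  have hli : LinearIndependent K fun i => (1 : K) ⊗ₜ[F] ![v, h v] i :=
    Flat.linearIndependent_one_tmul hv
  have h1 := LinearMap.congr_fun hc ((1 : K) ⊗ₜ[F] v)
  rw [LinearMap.baseChange_tmul] at h1
  have h2 := LinearIndependent.pair_iff.1 (by
    convert hli using 1
    ext i; fin_cases i <;> rfl : LinearIndependent K ![(1 : K) ⊗ₜ[F] v, (1 : K) ⊗ₜ[F] h v]) c (-1)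
  simp [h1] at h2

end BaseChange

section Tensor

variable {F A B : Type} [Field F] [AddCommGroup A] [Module F A] [AddCommGroup B] [Module F B]
  [FiniteDimensional F A] [FiniteDimensional F B]

lemma endFixDim_congr_le (g : A ≃ₗ[F] A) (s : B ≃ₗ[F] B) :
    endFixDim F (TensorProduct.congr g s).toLinearMap ≤
      finrank F (intertwiners (s.symm : B →ₗ[F] B).dualMap (g : A →ₗ[F] A)) := by
  let e : A ⊗[F] B ≃ₗ[F] (Dual F B →ₗ[F] A) :=
    (TensorProduct.comm F A B ≪≫ₗ
      TensorProduct.congr (evalEquiv F B) (LinearEquiv.refl F A)) ≪≫ₗ dualTensorHomEquiv F _ _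
  have he : ∀ a b (ξ : Dual F B), e (a ⊗ₜ b) ξ = ξ b • a := fun a b ξ => by
    simp [e, dualTensorHomEquiv]
  have hcomm : ∀ x, e (TensorProduct.congr g s x) ∘ₗ (s.symm : B →ₗ[F] B).dualMap =
      (g : A →ₗ[F] A) ∘ₗ e x := by
    intro x
    induction x using TensorProduct.induction_on with
    | zero => simp
    | tmul a b => ext ξ; simp [he]
    | add x y hx hy =>
      rw [map_add, map_add, map_add, LinearMap.add_comp, LinearMap.comp_add, hx, hy]
  rw [endFixDim, ← LinearEquiv.finrank_map_eq e]
  refine Submodule.finrank_mono ?_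
  rintro _ ⟨x, hx, rfl⟩
  have hx : TensorProduct.congr g s x = x := sub_eq_zero.1 hx
  have := hcomm x
  rwa [hx] at this

lemma endFixDim_congr_le_or_eq_smul_id (g : A ≃ₗ[F] A) (k : ℕ)
    (hk : ∀ p : F[X], p.Monic →
      finrank F (LinearMap.ker (aeval (g : Module.End F A) p)) ≤ p.natDegree * k)
    (s : B ≃ₗ[F] B) :
    (endFixDim F (TensorProduct.congr g s).toLinearMap : ℤ) ≤
        k * ((finrank F B : ℤ) - 2) + finrank F A ∨
      ∃ a : F, (s.symm : B →ₗ[F] B) = a • LinearMap.id ∧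
        endFixDim F (TensorProduct.congr g s).toLinearMap ≤
          finrank F (LinearMap.ker ((g : A →ₗ[F] A) - a • LinearMap.id)) * finrank F B := by
  have hle := endFixDim_congr_le g s
  by_cases hall : ∀ v, ¬ LinearIndependent F ![v, (s.symm : B →ₗ[F] B).dualMap v]
  · right
    obtain ⟨a, ha⟩ := LinearMap.exists_eq_smul_id_of_forall_notLinearIndependent hall
    refine ⟨a, ?_, ?_⟩
    · ext b
      rw [← sub_eq_zero, ← forall_dual_apply_eq_zero_iff F]
      intro ξ
      have := LinearMap.congr_fun (LinearMap.congr_fun ha ξ) b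
      simp only [LinearMap.dualMap_apply] at this
      rw [map_sub, this]
      simp
    · rw [ha] at hle
      have := finrank_intertwiners_smul_id_le (C := Dual F B) (g : Module.End F A) a
      rw [Subspace.dual_finrank_eq] at this
      exact hle.trans this
  · left
    push Not at hall
    obtain ⟨c, hc⟩ := hall
    have := finrank_intertwiners_le_of_linearIndependent (g : Module.End F A) k hk _ c hc
    rw [Subspace.dual_finrank_eq] at this
    exact (Int.ofNat_le.2 hle).trans this

lemma finrank_ker_baseChange_le_maxEigDimV (f : A →ₗ[F] A) (c : AlgebraicClosure F) :
    finrank (AlgebraicClosure F)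
      (LinearMap.ker (f.baseChange (AlgebraicClosure F) - c • LinearMap.id)) ≤ maxEigDimV F f := by
  refine le_csSup ⟨finrank F A, ?_⟩ ⟨c, rfl⟩
  rintro _ ⟨c, rfl⟩
  exact (Submodule.finrank_le _).trans finrank_baseChange.le

lemma exists_finrank_ker_baseChange_eq_maxEigDimV (f : A →ₗ[F] A) :
    ∃ c : AlgebraicClosure F, maxEigDimV F f = finrank (AlgebraicClosure F)
      (LinearMap.ker (f.baseChange (AlgebraicClosure F) - c • LinearMap.id)) := by
  refine Nat.sSup_mem (s := {d : ℕ | ∃ c : AlgebraicClosure F, d = finrank (AlgebraicClosure F)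
      (LinearMap.ker (f.baseChange (AlgebraicClosure F) - c • LinearMap.id))})
    ⟨_, 0, rfl⟩ ⟨finrank F A, ?_⟩
  rintro _ ⟨c, rfl⟩
  exact (Submodule.finrank_le _).trans finrank_baseChange.le

lemma finrank_ker_aeval_le_mul_maxEigDimV (f : Module.End F A) (p : F[X]) (hp : p.Monic) :
    finrank F (LinearMap.ker (aeval f p)) ≤ p.natDegree * maxEigDimV F f :=
  finrank_ker_aeval_le (AlgebraicClosure F) f _ (finrank_ker_baseChange_le_maxEigDimV f) p hp

lemma endFixDim_congr_le_maxEigDimV_mul (g : A ≃ₗ[F] A) (s : B ≃ₗ[F] B) :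
    endFixDim F (TensorProduct.congr g s).toLinearMap ≤
      maxEigDimV F (g : A →ₗ[F] A) * finrank F B := by
  have := finrank_intertwiners_le (g : Module.End F A) _ (finrank_ker_aeval_le_mul_maxEigDimV _)
    (s.symm : B →ₗ[F] B).dualMap
  rw [Subspace.dual_finrank_eq] at this
  exact (endFixDim_congr_le g s).trans this

lemma maxEigDimV_lt_finrank (f : A →ₗ[F] A) (hns : ∀ c : F, f ≠ c • LinearMap.id) :
    maxEigDimV F f < finrank F A := by
  obtain ⟨c, hc⟩ := exists_finrank_ker_baseChange_eq_maxEigDimV f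
  rw [hc, ← finrank_baseChange (R := AlgebraicClosure F) (S := F)]
  refine Submodule.finrank_lt fun htop => ?_
  exact baseChange_ne_smul_id _ f hns c (sub_eq_zero.1 (LinearMap.ker_eq_top.1 htop))

lemma finrank_ker_sub_smul_id_le_finrank_ker_baseChange (f : A →ₗ[F] A) (a : F) :
    finrank F (LinearMap.ker (f - a • LinearMap.id)) ≤ finrank (AlgebraicClosure F)
      (LinearMap.ker (f.baseChange (AlgebraicClosure F) -
        algebraMap F (AlgebraicClosure F) a • LinearMap.id)) := by
  refine (finrank_ker_le_finrank_ker_baseChange (AlgebraicClosure F) _).trans_eq ?_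
  rw [LinearMap.baseChange_sub, LinearMap.baseChange_smul, LinearMap.baseChange_id,
    algebraMap_smul]

lemma finrank_ker_sub_smul_id_le (f : A →ₗ[F] A) (a : F) :
    finrank F (LinearMap.ker (f - a • LinearMap.id)) ≤ maxEigDimV F f :=
  (finrank_ker_sub_smul_id_le_finrank_ker_baseChange f a).trans
    (finrank_ker_baseChange_le_maxEigDimV f _)

lemma finrank_ker_add_maxEigDimV_le (f : A →ₗ[F] A) {a b : F} (hab : a ≠ b) :
    finrank F (LinearMap.ker (f - a • LinearMap.id)) + maxEigDimV F f ≤ finrank F A ∨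
      finrank F (LinearMap.ker (f - b • LinearMap.id)) + maxEigDimV F f ≤ finrank F A := by
  obtain ⟨c, hc⟩ := exists_finrank_ker_baseChange_eq_maxEigDimV f
  have key : ∀ x : F, algebraMap F (AlgebraicClosure F) x ≠ c →
      finrank F (LinearMap.ker (f - x • LinearMap.id)) + maxEigDimV F f ≤ finrank F A := by
    intro x hx
    rw [hc, ← finrank_baseChange (R := AlgebraicClosure F) (S := F) (M' := A)]
    exact (Nat.add_le_add_right (finrank_ker_sub_smul_id_le_finrank_ker_baseChange f x) _).trans
      (finrank_ker_sub_smul_add_le _ hx)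
  by_cases ha : algebraMap F (AlgebraicClosure F) a = c
  · exact .inr (key b fun hb => hab ((algebraMap F (AlgebraicClosure F)).injective
      (ha.trans hb.symm)))
  · exact .inl (key a ha)

/-- A bound which is at least the one for non-scalar `s` and which two distinct scalars cannot
both exceed is exceeded by at most one `s`. -/
lemma subsingleton_setOf_lt_endFixDim (g : A ≃ₗ[F] A) (N : ℤ)
    (hN : maxEigDimV F (g : A →ₗ[F] A) * ((finrank F B : ℤ) - 2) + finrank F A ≤ N)
    (hsc : ∀ a b : F, a ≠ b →
      N < (finrank F (LinearMap.ker ((g : A →ₗ[F] A) - a • LinearMap.id)) * finrank F B : ℕ) →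
      N < (finrank F (LinearMap.ker ((g : A →ₗ[F] A) - b • LinearMap.id)) * finrank F B : ℕ) →
      False) :
    {s : B ≃ₗ[F] B |
      N < (endFixDim F (TensorProduct.congr g s).toLinearMap : ℤ)}.Subsingleton := by
  have key : ∀ s : B ≃ₗ[F] B, N < (endFixDim F (TensorProduct.congr g s).toLinearMap : ℤ) →
      ∃ a : F, (s.symm : B →ₗ[F] B) = a • LinearMap.id ∧ N <
        (finrank F (LinearMap.ker ((g : A →ₗ[F] A) - a • LinearMap.id)) * finrank F B : ℕ) := by
    intro s hs
    rcases endFixDim_congr_le_or_eq_smul_id g _ (finrank_ker_aeval_le_mul_maxEigDimV _) s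
      with h | ⟨a, ha, hle⟩
    · exact absurd (h.trans hN) hs.not_ge
    · exact ⟨a, ha, hs.trans_le (Int.ofNat_le.2 hle)⟩
  intro s hs t ht
  obtain ⟨a, ha, hsa⟩ := key s hs
  obtain ⟨b, hb, htb⟩ := key t ht
  by_cases hab : a = b
  · have : s.symm = t.symm := LinearEquiv.toLinearMap_injective (by rw [ha, hb, hab])
    simpa using congrArg LinearEquiv.symm this
  · exact (hsc a b hab hsa htb).elim

end Tensor

end FixedSpaces

/-- Lemma on fixed-point spaces of tensor products: for
`g ∈ GL(A)` with `δ_A(g) = k` and `V = A ⊗_F B`: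
(i) `d_V(g ⊗ s) ≤ kj` for all `s ∈ GL(B)`;
(ii) if `k ≥ n/2`, then `d_V(g ⊗ s) ≤ k(j-2) + n` for all but possibly one `s ∈ GL(B)`;
(iii) if `g` is not scalar and `j ≥ 2`, then `d_V(g ⊗ s) ≤ (n-1)j` for all `s`, and
`d_V(g ⊗ s) ≤ (n-1)(j-1) + 1` for all but possibly one `s ∈ GL(B)`. -/
theorem character_levels_stmt14 (F : Type) [Field F]
    (A B : Type) [AddCommGroup A] [Module F A] [AddCommGroup B] [Module F B]
    [FiniteDimensional F A] [FiniteDimensional F B]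
    (n j : ℕ) (hn : 1 ≤ n) (hj : 1 ≤ j)
    (hA : Module.finrank F A = n) (hB : Module.finrank F B = j)
    (g : A ≃ₗ[F] A) (k : ℕ) (hk : maxEigDimV F (g : A →ₗ[F] A) = k) :
    (∀ s : B ≃ₗ[F] B,
      endFixDim F (TensorProduct.congr g s).toLinearMap ≤ k * j) ∧
    (n ≤ 2 * k →
      {s : B ≃ₗ[F] B |
        (k : ℤ) * ((j : ℤ) - 2) + (n : ℤ) <
          (endFixDim F (TensorProduct.congr g s).toLinearMap : ℤ)}.Subsingleton) ∧
    ((∀ c : F, (g : A →ₗ[F] A) ≠ c • LinearMap.id) → 2 ≤ j →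
      (∀ s : B ≃ₗ[F] B,
        (endFixDim F (TensorProduct.congr g s).toLinearMap : ℤ) ≤ ((n : ℤ) - 1) * (j : ℤ)) ∧
      {s : B ≃ₗ[F] B |
        ((n : ℤ) - 1) * ((j : ℤ) - 1) + 1 <
          (endFixDim F (TensorProduct.congr g s).toLinearMap : ℤ)}.Subsingleton) := by
  subst hA hB hk
  refine ⟨endFixDim_congr_le_maxEigDimV_mul g, fun hn2 => ?_, fun hns hj2 => ⟨fun s => ?_, ?_⟩⟩
  · refine subsingleton_setOf_lt_endFixDim g _ le_rfl fun a b hab ha hb => ?_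
    have hsum := finrank_ker_sub_smul_add_le (g : A →ₗ[F] A) hab
    have hmax := finrank_ker_add_maxEigDimV_le (g : A →ₗ[F] A) hab
    generalize Module.finrank F (LinearMap.ker ((g : A →ₗ[F] A) - a • LinearMap.id)) = x at *
    generalize Module.finrank F (LinearMap.ker ((g : A →ₗ[F] A) - b • LinearMap.id)) = y at *
    generalize maxEigDimV F (g : A →ₗ[F] A) = k at *
    generalize Module.finrank F A = n at *
    generalize Module.finrank F B = j at *
    rcases hj.eq_or_lt with rfl | hj2
    · push_cast at ha hb
      omega
    · push_cast at ha hb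
      zify at hj2 hsum hn2
      nlinarith
  · have hk := maxEigDimV_lt_finrank (g : A →ₗ[F] A) hns
    refine (Int.ofNat_le.2 (endFixDim_congr_le_maxEigDimV_mul g s)).trans ?_
    rw [Int.natCast_mul]
    exact mul_le_mul_of_nonneg_right (by omega) (Int.natCast_nonneg _)
  · have hk := maxEigDimV_lt_finrank (g : A →ₗ[F] A) hns
    refine subsingleton_setOf_lt_endFixDim g _ ?_ fun a b hab ha hb => ?_
    · zify at hk hj2
      nlinarith
    · have hsum := finrank_ker_sub_smul_add_le (g : A →ₗ[F] A) hab
      have hx := finrank_ker_sub_smul_id_le (g : A →ₗ[F] A) a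
      have hy := finrank_ker_sub_smul_id_le (g : A →ₗ[F] A) b
      generalize Module.finrank F (LinearMap.ker ((g : A →ₗ[F] A) - a • LinearMap.id)) = x at *
      generalize Module.finrank F (LinearMap.ker ((g : A →ₗ[F] A) - b • LinearMap.id)) = y at *
      generalize maxEigDimV F (g : A →ₗ[F] A) = k at *
      generalize Module.finrank F A = n at *
      generalize Module.finrank F B = j at *
      have hn2 : 2 ≤ n := by
        by_contra hlt
        obtain rfl : n = 1 := by omega
        obtain rfl : x = 0 := by omega
        push_cast at ha
        omega
      push_cast at ha hb
      zify at hj2 hsum hn2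
      nlinarith [mul_nonneg (sub_nonneg.2 hn2) (sub_nonneg.2 hj2)]
end

section
/- Let λ = (λ_1 ≥ λ_2 ≥ … ≥ λ_r ≥ 0) be a partition of n with largest part λ_1 = k satisfying 2 ≤ k ≤ n/2, and set [λ] = n² − 2·Σ_{i=1}^{r} λ_i². Then [λ] ≥ 0. Moreover, either [λ] ≥ 2.4·n, or one of the following holds: (i) n = 3k = 6 and λ = (2,2,2); (ii) n = 2k+1 and either λ = (k,k,1) or λ ∈ {(3,2,2), (2,1,1,1)}; (iii) n = 2k and either λ ∈ {(k,k), (k,k−1,1)} or λ ∈ {(4,2,2), (3,1,1,1)}. -/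
/-- `[λ] = n² - 2 Σᵢ λᵢ²` for a partition `λ` of `n`. -/
def partitionBracket (n : ℕ) (P : Nat.Partition n) : ℤ :=
  (n : ℤ) ^ 2 - 2 * (P.parts.map (fun a => (a : ℤ) ^ 2)).sum

theorem Multiset.sum_map_sq_le_mul_sum (s : Multiset ℕ) (m : ℕ) (h : ∀ a ∈ s, a ≤ m) :
    (s.map (fun a : ℕ => (a : ℤ) ^ 2)).sum ≤ (m : ℤ) * (s.sum : ℤ) := by
  induction s using Multiset.induction with
  | empty => simp
  | cons a s ih =>
    have ha : (a : ℤ) ≤ m := by exact_mod_cast h a (Multiset.mem_cons_self a s)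
    have hs := ih fun b hb => h b (Multiset.mem_cons_of_mem hb)
    simp only [Multiset.map_cons, Multiset.sum_cons, Nat.cast_add]
    nlinarith [mul_le_mul_of_nonneg_right ha (Int.natCast_nonneg a)]

theorem partitionBracket_eq (n : ℕ) (P : Nat.Partition n) :
    partitionBracket n P =
      (n : ℤ) ^ 2 - 2 * (P.parts.map (fun a : ℕ => (a : ℤ) ^ 2)).sum := by
  simp [partitionBracket, Multiset.bind_def, Multiset.pure_def, Multiset.bind_singleton]

theorem Multiset.eq_zero_of_pos_of_sum_eq_zero (s : Multiset ℕ) (h : ∀ a ∈ s, 0 < a)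
    (hs : s.sum = 0) : s = 0 :=
  Multiset.eq_zero_of_forall_notMem fun a ha =>
    (h a ha).ne' (Multiset.sum_eq_zero_iff.mp hs a ha)

theorem Multiset.eq_singleton_one_of_pos_of_sum_eq_one (s : Multiset ℕ) (h : ∀ a ∈ s, 0 < a)
    (hs : s.sum = 1) : s = {1} := by
  induction s using Multiset.induction with
  | empty => simp at hs
  | cons a s _ =>
    have ha := h a (Multiset.mem_cons_self a s)
    rw [Multiset.sum_cons] at hs
    rw [Multiset.eq_zero_of_pos_of_sum_eq_zero s (fun b hb => h b (Multiset.mem_cons_of_mem hb))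
      (by omega), show a = 1 by omega]
    rfl

theorem Multiset.eq_of_pos_of_sum_eq_two (s : Multiset ℕ) (h : ∀ a ∈ s, 0 < a)
    (hs : s.sum = 2) : s = {2} ∨ s = {1, 1} := by
  induction s using Multiset.induction with
  | empty => simp at hs
  | cons a s _ =>
    have ha := h a (Multiset.mem_cons_self a s)
    have hpos : ∀ b ∈ s, 0 < b := fun b hb => h b (Multiset.mem_cons_of_mem hb)
    rw [Multiset.sum_cons] at hs
    obtain rfl | rfl : a = 1 ∨ a = 2 := by omega
    · rw [Multiset.eq_singleton_one_of_pos_of_sum_eq_one s hpos (by omega)]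
      exact Or.inr rfl
    · rw [Multiset.eq_zero_of_pos_of_sum_eq_zero s hpos (by omega)]
      exact Or.inl rfl

theorem Multiset.exists_eq_cons_max (s : Multiset ℕ) (hs : s ≠ 0) :
    ∃ m R, s = m ::ₘ R ∧ ∀ a ∈ R, a ≤ m := by
  obtain ⟨m, hm, hmax⟩ := s.toFinset.exists_max_image id (by simpa using hs)
  rw [Multiset.mem_toFinset] at hm
  refine ⟨m, s.erase m, (Multiset.cons_erase hm).symm, fun a ha => ?_⟩
  exact hmax a (by simpa using Multiset.mem_of_mem_erase ha)

/-- Lemma on partitions: if `λ ⊢ n` has largest part `k` with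
`2 ≤ k ≤ n/2`, then `[λ] ≥ 0`; moreover either `[λ] ≥ 2.4 n` or `λ` is one of the listed
exceptions. -/
theorem character_levels_stmt15 (n k : ℕ) (P : Nat.Partition n)
    (hk2 : 2 ≤ k) (hkn : 2 * k ≤ n)
    (hmem : k ∈ P.parts) (hmax : ∀ a ∈ P.parts, a ≤ k) :
    0 ≤ partitionBracket n P ∧
    ((2.4 * (n : ℝ) ≤ (partitionBracket n P : ℝ)) ∨
      (n = 3 * k ∧ n = 6 ∧ P.parts = {2, 2, 2}) ∨
      (n = 2 * k + 1 ∧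
        (P.parts = {k, k, 1} ∨ P.parts = {3, 2, 2} ∨ P.parts = {2, 1, 1, 1})) ∨
      (n = 2 * k ∧
        (P.parts = {k, k} ∨ P.parts = {k, k - 1, 1} ∨
          P.parts = {4, 2, 2} ∨ P.parts = {3, 1, 1, 1}))) := by
  have hbound := Multiset.sum_map_sq_le_mul_sum P.parts k hmax
  rw [P.parts_sum] at hbound
  have hkn' : 2 * (k : ℤ) ≤ n := by exact_mod_cast hkn
  have hn0 : (0 : ℤ) ≤ n := Int.natCast_nonneg n
  refine ⟨by rw [partitionBracket_eq]; nlinarith, ?_⟩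
  have key : 12 * (n : ℤ) ≤ 5 * partitionBracket n P →
      2.4 * (n : ℝ) ≤ (partitionBracket n P : ℝ) := fun h => by
    have h' : 12 * (n : ℝ) ≤ 5 * (partitionBracket n P : ℝ) := by exact_mod_cast h
    linarith
  by_cases hlarge : 2 * k + 3 ≤ n
  · have : 2 * (k : ℤ) + 3 ≤ n := by exact_mod_cast hlarge
    exact Or.inl (key (by rw [partitionBracket_eq]; nlinarith))
  obtain ⟨Q, hQ⟩ := Multiset.exists_cons_of_mem hmem
  have hsumQ : k + Q.sum = n := by rw [← Multiset.sum_cons, ← hQ, P.parts_sum]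
  obtain ⟨m, R, rfl, hR⟩ := Multiset.exists_eq_cons_max Q (by rintro rfl; simp at hsumQ; omega)
  have hmk : m ≤ k := hmax m (by simp [hQ])
  have hm : 0 < m := P.parts_pos (by simp [hQ])
  have hpos : ∀ a ∈ R, 0 < a := fun a ha => P.parts_pos (by simp [hQ, ha])
  rw [Multiset.sum_cons] at hsumQ
  have hsq := Multiset.sum_map_sq_le_mul_sum R m hR
  have hbr : partitionBracket n P =
      (n : ℤ) ^ 2 - 2 * ((k : ℤ) ^ 2 + (m ^ 2 + (R.map (fun a : ℕ => (a : ℤ) ^ 2)).sum)) := by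
    simp [partitionBracket_eq, hQ]
  have hsumZ : (k : ℤ) + (m + R.sum) = n := by exact_mod_cast hsumQ
  have hk2' : (2 : ℤ) ≤ k := by exact_mod_cast hk2
  obtain rfl | rfl | rfl : n = 2 * k ∨ n = 2 * k + 1 ∨ n = 2 * k + 2 := by omega
  · by_cases hd : m + 3 ≤ k
    · have hd' : (m : ℤ) + 3 ≤ k := by exact_mod_cast hd
      refine Or.inl (key ?_)
      rw [hbr]
      push_cast [-Nat.cast_multiset_sum] at hsumZ ⊢
      have : (R.sum : ℤ) = k - m := by linarith
      rw [this] at hsq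
      nlinarith
    obtain rfl | rfl | rfl : k = m ∨ k = m + 1 ∨ k = m + 2 := by omega
    · obtain rfl := Multiset.eq_zero_of_pos_of_sum_eq_zero R hpos (by omega)
      exact Or.inr (Or.inr (Or.inr ⟨rfl, Or.inl hQ⟩))
    · obtain rfl := Multiset.eq_singleton_one_of_pos_of_sum_eq_one R hpos (by omega)
      exact Or.inr (Or.inr (Or.inr ⟨rfl, Or.inr (Or.inl hQ)⟩))
    · obtain rfl | rfl := Multiset.eq_of_pos_of_sum_eq_two R hpos (by omega)
      · by_cases h3 : 3 ≤ m
        · refine Or.inl (key ?_)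
          have : (3 : ℤ) ≤ m := by exact_mod_cast h3
          rw [hbr]
          simp
          nlinarith
        · obtain rfl | rfl : m = 1 ∨ m = 2 := by omega
          · simp at hR
          · exact Or.inr (Or.inr (Or.inr ⟨rfl, Or.inr (Or.inr (Or.inl hQ))⟩))
      · by_cases h2 : 2 ≤ m
        · refine Or.inl (key ?_)
          have : (2 : ℤ) ≤ m := by exact_mod_cast h2
          rw [hbr]
          simp
          nlinarith
        · obtain rfl : m = 1 := by omega
          exact Or.inr (Or.inr (Or.inr ⟨rfl, Or.inr (Or.inr (Or.inr hQ))⟩))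
  · by_cases hd : m + 2 ≤ k
    · have hd' : (m : ℤ) + 2 ≤ k := by exact_mod_cast hd
      refine Or.inl (key ?_)
      rw [hbr]
      push_cast [-Nat.cast_multiset_sum] at hsumZ ⊢
      have : (R.sum : ℤ) = k + 1 - m := by linarith
      rw [this] at hsq
      nlinarith
    obtain rfl | rfl : k = m ∨ k = m + 1 := by omega
    · obtain rfl := Multiset.eq_singleton_one_of_pos_of_sum_eq_one R hpos (by omega)
      exact Or.inr (Or.inr (Or.inl ⟨rfl, Or.inl hQ⟩))
    · obtain rfl | rfl := Multiset.eq_of_pos_of_sum_eq_two R hpos (by omega)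
      · by_cases h3 : 3 ≤ m
        · refine Or.inl (key ?_)
          have : (3 : ℤ) ≤ m := by exact_mod_cast h3
          rw [hbr]
          simp
          nlinarith
        · obtain rfl | rfl : m = 1 ∨ m = 2 := by omega
          · simp at hR
          · exact Or.inr (Or.inr (Or.inl ⟨rfl, Or.inr (Or.inl hQ)⟩))
      · by_cases h2 : 2 ≤ m
        · refine Or.inl (key ?_)
          have : (2 : ℤ) ≤ m := by exact_mod_cast h2
          rw [hbr]
          simp
          nlinarith
        · obtain rfl : m = 1 := by omega
          exact Or.inr (Or.inr (Or.inl ⟨rfl, Or.inr (Or.inr hQ)⟩))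
  · by_cases hd : m + 1 ≤ k
    · have hd' : (m : ℤ) + 1 ≤ k := by exact_mod_cast hd
      refine Or.inl (key ?_)
      rw [hbr]
      push_cast [-Nat.cast_multiset_sum] at hsumZ ⊢
      have : (R.sum : ℤ) = k + 2 - m := by linarith
      rw [this] at hsq
      nlinarith
    obtain rfl : k = m := by omega
    obtain rfl | rfl := Multiset.eq_of_pos_of_sum_eq_two R hpos (by omega)
    · by_cases h3 : 3 ≤ k
      · refine Or.inl (key ?_)
        have : (3 : ℤ) ≤ k := by exact_mod_cast h3
        rw [hbr]
        simp
        nlinarith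
      · obtain rfl : k = 2 := by omega
        exact Or.inr (Or.inl ⟨rfl, rfl, hQ⟩)
    · refine Or.inl (key ?_)
      rw [hbr]
      simp
      nlinarith
end

section
/- Let q be a prime power, n ≥ 1, and G = GU_n(q). (i) If i and j are non-negative integers with i + j ≤ n and i + j odd, then the class functions (ζ_n)^i and (ζ_n)^j have no common irreducible constituent; that is, there is no χ ∈ Irr(G) with both [(ζ_n)^i, χ]_G ≠ 0 and [(ζ_n)^j, χ]_G ≠ 0. (ii) In particular, if 0 ≤ j ≤ n/2, then every irreducible constituent χ of (ζ_n)^j has true level l*(χ) = j − 2t for some integer 0 ≤ t ≤ j/2. -/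
open Matrix in
/-- Fewer than `n / 2` vectors in a nondegenerate hermitian space of dimension `n` have a common
anisotropic orthogonal vector. -/
theorem exists_star_self_ne_zero {K : Type*} [Field K] [StarRing K] (hstar : ∃ z : K, star z ≠ z)
    {n : ℕ} {ι : Type*} [Fintype ι] (w : ι → Fin n → K) (hw : 2 * Fintype.card ι < n) :
    ∃ v : Fin n → K, (∀ k, star v ⬝ᵥ w k = 0) ∧ star v ⬝ᵥ v ≠ 0 := by
  classical
  by_contra! hiso
  let C : Matrix ι (Fin n) K := Matrix.of fun k => star (w k)
  let N := LinearMap.ker C.mulVecLin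
  have hN : ∀ u, u ∈ N ↔ ∀ k, star u ⬝ᵥ w k = 0 := by
    intro u
    have hC : ∀ k, (C *ᵥ u) k = star (star u ⬝ᵥ w k) := fun k => star_dotProduct (w k) u
    rw [LinearMap.mem_ker, mulVecLin_apply, funext_iff]
    simp [hC]
  have horth : ∀ u ∈ N, ∀ v ∈ N, star u ⬝ᵥ v = 0 := by
    intro u hu v hv
    have hself : ∀ x ∈ N, star x ⬝ᵥ x = 0 := fun x hx => hiso x ((hN x).1 hx)
    have hpol : ∀ c : K, c * (star u ⬝ᵥ v) + star c * star (star u ⬝ᵥ v) = 0 := by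
      intro c
      have h1 := hself _ (N.add_mem hu (N.smul_mem c hv))
      have h2 := hself u hu
      have h3 := hself v hv
      rw [← star_dotProduct v u]
      simp only [star_add, star_smul, dotProduct_add, add_dotProduct, smul_dotProduct,
        dotProduct_smul, h2, h3, smul_eq_mul] at h1
      linear_combination h1
    by_contra ht
    set t := star u ⬝ᵥ v
    have hz : ∀ z : K, z + star z = 0 := by
      intro z
      have := hpol (z / t)
      rwa [← star_mul', div_mul_cancel₀ _ ht] at this
    obtain ⟨z, hz'⟩ := hstar
    have h1 := hz 1
    rw [star_one] at h1
    apply hz'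
    linear_combination (hz z) - z * h1
  have hle : N ≤ Submodule.span K (Set.range w) := by
    intro u hu
    let L : ι → (Fin n → K) →ₗ[K] K := fun k => dotProductBilin K K (star (w k))
    have hker : ⨅ k, LinearMap.ker (L k) ≤ LinearMap.ker (dotProductBilin K K (star u)) := by
      intro v hv
      refine horth u hu v ((hN v).2 fun k => ?_)
      have : star (w k) ⬝ᵥ v = 0 := (Submodule.mem_iInf _).1 hv k
      rw [star_dotProduct, this, star_zero]
    obtain ⟨c, hc⟩ := (Submodule.mem_span_range_iff_exists_fun K).1
      (mem_span_of_iInf_ker_le_ker hker)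
    refine (Submodule.mem_span_range_iff_exists_fun K).2 ⟨fun k => star (c k), ?_⟩
    ext i
    have := LinearMap.congr_fun hc (Pi.single i 1)
    simp only [L, LinearMap.coe_sum, Finset.sum_apply, LinearMap.smul_apply] at this
    have := congrArg star this
    simpa [dotProductBilin, Finset.sum_apply] using this
  have h1 := LinearMap.finrank_range_add_finrank_ker C.mulVecLin
  have h2 := Submodule.finrank_le (LinearMap.range C.mulVecLin)
  have h3 := (Submodule.finrank_mono hle).trans (finrank_range_le_card w)
  simp only [Module.finrank_fintype_fun_eq_card, Fintype.card_fin] at h1 h2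
  change _ + Module.finrank K N = _ at h1
  omega

open Matrix in
/-- The unitary reflection scaling `v` by `a` and fixing the orthogonal complement of `v`. -/
def unitaryReflection {K : Type*} [Field K] [StarRing K] {n : ℕ} (v : Fin n → K) (a : K) :
    Matrix (Fin n) (Fin n) K :=
  1 + ((a - 1) * (star v ⬝ᵥ v)⁻¹) • vecMulVec v (star v)

theorem finrank_eq_finrank_inf_ker {K V : Type*} [Field K] [AddCommGroup V] [Module K V]
    [FiniteDimensional K V] (f : V →ₗ[K] K) (p : Submodule K V) :
    ((∃ w ∈ p, f w ≠ 0) →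
      Module.finrank K p = Module.finrank K ↥(p ⊓ LinearMap.ker f) + 1) ∧
    ((¬ ∃ w ∈ p, f w ≠ 0) →
      Module.finrank K p = Module.finrank K ↥(p ⊓ LinearMap.ker f)) := by
  constructor
  · rintro ⟨w, hwp, hw⟩
    have hne : f.domRestrict p ≠ 0 := fun h => hw (LinearMap.congr_fun h ⟨w, hwp⟩)
    have h1 := Module.Dual.finrank_ker_add_one_of_ne_zero (f := f.domRestrict p) hne
    rw [← h1, LinearMap.ker_domRestrict, ← Submodule.finrank_map_subtype_eq,
      Submodule.map_comap_subtype]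
  · intro h
    push Not at h
    rw [inf_eq_left.2 (fun w hw => h w hw)]

section Reflection

open Matrix

variable {K : Type*} [Field K] [StarRing K] {n : ℕ}

theorem unitaryReflection_mulVec (v : Fin n → K) (a : K) (w : Fin n → K) :
    unitaryReflection v a *ᵥ w = w + ((a - 1) * (star v ⬝ᵥ v)⁻¹ * (star v ⬝ᵥ w)) • v := by
  rw [unitaryReflection, add_mulVec, one_mulVec, smul_mulVec, vecMulVec_mulVec]
  simp [smul_smul]

theorem unitaryReflection_conjTranspose_mul {v : Fin n → K} (hv : star v ⬝ᵥ v ≠ 0) {a : K}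
    (ha : star a * a = 1) :
    (unitaryReflection v a)ᴴ * unitaryReflection v a = 1 := by
  have hs : star (star v ⬝ᵥ v) = star v ⬝ᵥ v := (star_dotProduct v v).symm
  have hvv : vecMulVec v (star v) * vecMulVec v (star v)
      = (star v ⬝ᵥ v) • vecMulVec v (star v) := by
    rw [vecMulVec_mul_vecMulVec, vecMulVec_smul]
  have hc : (vecMulVec v (star v))ᴴ = vecMulVec v (star v) := by
    rw [conjTranspose_vecMulVec, star_star]
  rw [unitaryReflection, conjTranspose_add, conjTranspose_one, conjTranspose_smul, hc, add_mul,
    mul_add, mul_add, one_mul, one_mul, mul_one, smul_mul_smul_comm, hvv, smul_smul,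
    add_assoc, ← add_smul, ← add_smul]
  set β := star v ⬝ᵥ v
  have : (a - 1) * β⁻¹ + (star ((a - 1) * β⁻¹) + star ((a - 1) * β⁻¹) * ((a - 1) * β⁻¹) * β)
      = 0 := by
    rw [star_mul', star_inv₀, hs, star_sub, star_one]
    field_simp
    linear_combination ha
  rw [this, zero_smul, add_zero]

theorem star_mulVec_dotProduct_mulVec {g : Matrix (Fin n) (Fin n) K} (hg : gᴴ * g = 1)
    (x y : Fin n → K) : star (g *ᵥ x) ⬝ᵥ g *ᵥ y = star x ⬝ᵥ y := by
  rw [star_mulVec, ← dotProduct_mulVec, mulVec_mulVec, hg, one_mulVec]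

theorem mulVec_eq_of_conjTranspose_mulVec_eq {g : Matrix (Fin n) (Fin n) K} (hg : gᴴ * g = 1)
    {x y : Fin n → K} (h : gᴴ *ᵥ x = y) : g *ᵥ y = x := by
  rw [← h, mulVec_mulVec, mul_eq_one_comm.1 hg, one_mulVec]

/-- A vector orthogonal to the fixed space of `g` is of the form `gᴴ w - w`. -/
theorem exists_conjTranspose_mulVec_eq_add {g : Matrix (Fin n) (Fin n) K} {v : Fin n → K}
    (hv : ∀ w, g *ᵥ w = w → star v ⬝ᵥ w = 0) :
    ∃ w, gᴴ *ᵥ w = w + v := by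
  by_contra! hw
  have hnot : v ∉ LinearMap.range (gᴴ - 1).mulVecLin := by
    rintro ⟨w, h⟩
    apply hw w
    rw [← h, mulVecLin_apply, sub_mulVec, one_mulVec]
    abel
  obtain ⟨f, hf, hfr⟩ := Submodule.exists_dual_map_eq_bot_of_notMem hnot inferInstance
  obtain ⟨r, rfl⟩ := (dotProductEquiv K (Fin n)).surjective f
  have hr : ∀ x, r ⬝ᵥ ((gᴴ - 1) *ᵥ x) = 0 := by
    intro x
    have : dotProductEquiv K (Fin n) r ((gᴴ - 1) *ᵥ x) ∈
        Submodule.map (dotProductEquiv K (Fin n) r) (LinearMap.range (gᴴ - 1).mulVecLin) :=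
      ⟨_, ⟨x, rfl⟩, rfl⟩
    rw [hfr] at this
    exact this
  have hr' : r ᵥ* (gᴴ - 1) = 0 := by
    ext i
    have := hr (Pi.single i 1)
    rw [dotProduct_mulVec] at this
    simpa using this
  have hr2 : r ᵥ* gᴴ = r := by
    rwa [vecMul_sub, vecMul_one, sub_eq_zero] at hr'
  have hfix : g *ᵥ star r = star r := by
    apply star_injective
    rw [star_mulVec, star_star, hr2]
  apply hf
  have := hv _ hfix
  rw [star_dotProduct, star_eq_zero, star_star] at this
  exact this

theorem existsUnique_reflection_fixes {g : Matrix (Fin n) (Fin n) K} (hg : gᴴ * g = 1)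
    {v : Fin n → K} (hv : star v ⬝ᵥ v ≠ 0) :
    ∃! a : K, star a * a = 1 ∧ ∃ w, star v ⬝ᵥ w ≠ 0 ∧
      (g * unitaryReflection v a) *ᵥ w = w := by
  have hs : star (star v ⬝ᵥ v) = star v ⬝ᵥ v := (star_dotProduct v v).symm
  have hg' : gᴴᴴ * gᴴ = 1 := by rw [conjTranspose_conjTranspose]; exact mul_eq_one_comm.1 hg
  refine existsUnique_of_exists_of_unique ?_ ?_
  · by_cases hfix : ∀ w, g *ᵥ w = w → star v ⬝ᵥ w = 0
    · obtain ⟨w, hw⟩ := exists_conjTranspose_mulVec_eq_add hfix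
      have hn := star_mulVec_dotProduct_mulVec hg' w w
      rw [hw] at hn
      simp only [star_add, dotProduct_add, add_dotProduct] at hn
      rw [star_dotProduct w v] at hn
      set x := star v ⬝ᵥ w with hx
      set β := star v ⬝ᵥ v with hβ
      have hn' : star x + x + β = 0 := by linear_combination hn
      have hx0 : x ≠ 0 := by
        intro h0
        rw [h0, star_zero, zero_add, zero_add] at hn'
        exact hv hn'
      have hsx0 : star x ≠ 0 := star_ne_zero.2 hx0
      refine ⟨(x + β) / x, ?_, w, hx0, ?_⟩
      · rw [star_div₀, star_add, hs]
        field_simp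
        linear_combination β * hn'
      · rw [← mulVec_mulVec, unitaryReflection_mulVec]
        apply mulVec_eq_of_conjTranspose_mulVec_eq hg
        rw [hw, ← hx, ← hβ]
        have : ((x + β) / x - 1) * β⁻¹ * x = 1 := by
          field_simp
          ring
        rw [this, one_smul]
    · push Not at hfix
      obtain ⟨w, hw, hvw⟩ := hfix
      refine ⟨1, by simp, w, hvw, ?_⟩
      rw [← mulVec_mulVec, unitaryReflection_mulVec]
      simpa using hw
  · rintro a b ⟨ha, w, hw, haw⟩ ⟨hb, u, hu, hbu⟩
    have key := star_mulVec_dotProduct_mulVec hg (unitaryReflection v a *ᵥ w)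
      (unitaryReflection v b *ᵥ u)
    rw [mulVec_mulVec, mulVec_mulVec, haw, hbu, unitaryReflection_mulVec,
      unitaryReflection_mulVec] at key
    simp only [star_add, star_smul, dotProduct_add, add_dotProduct, smul_dotProduct,
      dotProduct_smul, smul_eq_mul, star_mul', star_sub, star_one, star_inv₀] at key
    rw [star_dotProduct w v, hs] at key
    set x := star v ⬝ᵥ w
    set y := star v ⬝ᵥ u
    have hsx0 : star x ≠ 0 := star_ne_zero.2 hw
    field_simp at key
    have h1 : star a * b = 1 := by
      apply mul_left_cancel₀ (mul_ne_zero hsx0 hu)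
      linear_combination -key
    have hsa : star a ≠ 0 := left_ne_zero_of_mul_eq_one ha
    exact mul_left_cancel₀ hsa (ha.trans h1.symm)

/-- The function `(-q) ^ dim ker (x - 1)` sums to zero over the coset `g R_a`, where `R_a` runs
over the reflections along an anisotropic vector `v`. -/
theorem sum_neg_pow_finrank_fixed_mul_reflection [Fintype K] [DecidableEq K] {q : ℕ}
    (hμ : (Finset.univ.filter fun a : K => star a * a = 1).card = q + 1)
    {g : Matrix (Fin n) (Fin n) K} (hg : gᴴ * g = 1) {v : Fin n → K} (hv : star v ⬝ᵥ v ≠ 0) :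
    ∑ a ∈ Finset.univ.filter fun a : K => star a * a = 1,
      (-q : ℂ) ^ Module.finrank K
        (LinearMap.ker (g * unitaryReflection v a - 1).mulVecLin) = 0 := by
  obtain ⟨a₀, ⟨ha₀, hw₀⟩, huniq⟩ := existsUnique_reflection_fixes hg hv
  let f : (Fin n → K) →ₗ[K] K := dotProductBilin K K (star v)
  have hmem : ∀ (a : K) (w : Fin n → K),
      w ∈ LinearMap.ker (g * unitaryReflection v a - 1).mulVecLin ↔
        (g * unitaryReflection v a) *ᵥ w = w := by
    intro a w
    rw [LinearMap.mem_ker, mulVecLin_apply, sub_mulVec, one_mulVec, sub_eq_zero]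
  let F := LinearMap.ker (g - 1).mulVecLin ⊓ LinearMap.ker f
  have hF : ∀ a : K,
      LinearMap.ker (g * unitaryReflection v a - 1).mulVecLin ⊓ LinearMap.ker f = F := by
    intro a
    ext w
    simp only [F, Submodule.mem_inf, hmem]
    refine and_congr_left fun hw => ?_
    have hw' : star v ⬝ᵥ w = 0 := hw
    rw [← mulVec_mulVec, unitaryReflection_mulVec, hw', mul_zero, zero_smul, add_zero,
      LinearMap.mem_ker, mulVecLin_apply, sub_mulVec, one_mulVec, sub_eq_zero]
  have h₀ : Module.finrank K (LinearMap.ker (g * unitaryReflection v a₀ - 1).mulVecLin)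
      = Module.finrank K F + 1 := by
    rw [← hF a₀]
    obtain ⟨w, hw1, hw2⟩ := hw₀
    exact (finrank_eq_finrank_inf_ker f _).1 ⟨w, (hmem a₀ w).2 hw2, hw1⟩
  have h₁ : ∀ a : K, star a * a = 1 → a ≠ a₀ →
      Module.finrank K (LinearMap.ker (g * unitaryReflection v a - 1).mulVecLin)
      = Module.finrank K F := by
    intro a ha hne
    rw [← hF a]
    refine (finrank_eq_finrank_inf_ker f _).2 ?_
    rintro ⟨w, hw1, hw2⟩
    exact hne (huniq a ⟨ha, w, hw2, (hmem a w).1 hw1⟩)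
  have hin : a₀ ∈ Finset.univ.filter fun a : K => star a * a = 1 := by simpa using ha₀
  rw [← Finset.add_sum_erase _ _ hin, h₀, Finset.sum_congr rfl (g := fun _ =>
    (-q : ℂ) ^ Module.finrank K F), Finset.sum_const, Finset.card_erase_of_mem hin, hμ]
  · simp
    ring
  · intro a ha
    rw [Finset.mem_erase, Finset.mem_filter] at ha
    rw [h₁ a ha.2.2 ha.1]

end Reflection

/-- The involution `x ↦ x ^ q` makes a field with `q ^ 2` elements a star ring. -/
abbrev frobStarRing (q : ℕ) (K : Type) [Field K] [Fintype K] (hK : Fintype.card K = q ^ 2) :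
    StarRing K where
  star := qFrob q K hK
  star_involutive x := by
    change (x ^ q) ^ q = x
    rw [← pow_mul, ← sq, ← hK, FiniteField.pow_card]
  star_mul x y := by rw [map_mul, mul_comm]
  star_add := map_add _

section WeilCharacter

variable {q n : ℕ} {K : Type} [Field K]

theorem weilOn_eq (H : Subgroup (Matrix (Fin n) (Fin n) K)ˣ) (g : H) :
    weilOn q false H g = (-1) ^ n * (-q : ℂ) ^ fixedDim (g : (Matrix (Fin n) (Fin n) K)ˣ) := by
  simp [weilOn, weilChar, esgn]

theorem star_weilOn (H : Subgroup (Matrix (Fin n) (Fin n) K)ˣ) (g : H) :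
    (starRingEnd ℂ) (weilOn q false H g) = weilOn q false H g := by
  simp [weilOn_eq]

theorem fixedDim_conj (h g : (Matrix (Fin n) (Fin n) K)ˣ) :
    fixedDim (h * g * h⁻¹) = fixedDim g := by
  have hrank : ((h * g * h⁻¹ : (Matrix (Fin n) (Fin n) K)ˣ) : Matrix (Fin n) (Fin n) K) - 1
      = h * ((g : Matrix (Fin n) (Fin n) K) - 1) * (h⁻¹ : (Matrix (Fin n) (Fin n) K)ˣ) := by
    rw [mul_sub, sub_mul, mul_one, Units.mul_inv, Units.val_mul, Units.val_mul]
  have hr : (((h * g * h⁻¹ : (Matrix (Fin n) (Fin n) K)ˣ) : Matrix (Fin n) (Fin n) K) - 1).rank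
      = ((g : Matrix (Fin n) (Fin n) K) - 1).rank := by
    rw [hrank, Matrix.rank_mul_eq_left_of_isUnit_det, Matrix.rank_mul_eq_right_of_isUnit_det]
    · exact (Matrix.isUnit_iff_isUnit_det _).1 h.isUnit
    · exact (Matrix.isUnit_iff_isUnit_det _).1 h⁻¹.isUnit
  have h1 := LinearMap.finrank_range_add_finrank_ker (Matrix.mulVecLin
    (((h * g * h⁻¹ : (Matrix (Fin n) (Fin n) K)ˣ) : Matrix (Fin n) (Fin n) K) - 1))
  have h2 := LinearMap.finrank_range_add_finrank_ker (Matrix.mulVecLin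
    ((g : Matrix (Fin n) (Fin n) K) - 1))
  unfold Matrix.rank at hr
  unfold fixedDim
  omega

theorem weilOn_conj (H : Subgroup (Matrix (Fin n) (Fin n) K)ˣ) (h g : H) :
    weilOn q false H (h * g * h⁻¹) = weilOn q false H g := by
  rw [weilOn_eq, weilOn_eq]
  congr 2
  exact fixedDim_conj h.1 g.1

end WeilCharacter

section FiniteUnitary

variable {q : ℕ} {K : Type} [Field K] [Fintype K]

theorem one_lt_of_card_eq_sq (hK : Fintype.card K = q ^ 2) : 1 < q := by
  have h := Fintype.one_lt_card (α := K)
  rw [hK] at h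
  by_contra! h'
  interval_cases q <;> simp at h

theorem card_pow_mul_self_eq_one [DecidableEq K] (hK : Fintype.card K = q ^ 2) :
    (Finset.univ.filter fun a : K => a ^ q * a = 1).card = q + 1 := by
  have hq := one_lt_of_card_eq_sq hK
  have h1 := IsCyclic.card_powMonoidHom_ker Kˣ (q + 1)
  have h2 : Nat.card Kˣ = (q + 1) * (q - 1) := by
    rw [Nat.card_eq_fintype_card, Fintype.card_units, hK, ← Nat.sq_sub_sq, one_pow]
  rw [h2, Nat.gcd_comm, Nat.gcd_mul_right_right] at h1
  rw [← h1, ← Fintype.card_coe, ← Nat.card_eq_fintype_card]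
  refine Nat.card_congr
    { toFun := fun a => ⟨Units.mkOfMulEqOne a.1 (a.1 ^ q) (by
        rw [mul_comm]; exact (Finset.mem_filter.1 a.2).2), ?_⟩
      invFun := fun u => ⟨(u.1 : K), ?_⟩
      left_inv := fun a => rfl
      right_inv := fun u => by ext; rfl }
  · rw [MonoidHom.mem_ker, powMonoidHom_apply]
    ext
    simpa [pow_succ] using (Finset.mem_filter.1 a.2).2
  · have := u.2
    rw [MonoidHom.mem_ker, powMonoidHom_apply] at this
    have := congrArg Units.val this
    simpa [pow_succ] using this

theorem exists_pow_ne_self (hK : Fintype.card K = q ^ 2) : ∃ z : K, z ^ q ≠ z := by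
  classical
  by_contra! h
  have hq := one_lt_of_card_eq_sq hK
  have h1 := card_pow_mul_self_eq_one hK
  have h2 : (Finset.univ.filter fun a : K => a ^ q * a = 1) ⊆ {1, -1} := by
    intro a ha
    rw [Finset.mem_filter, h a] at ha
    rw [Finset.mem_insert, Finset.mem_singleton]
    exact mul_self_eq_one_iff.1 ha.2
  have h3 := (Finset.card_le_card h2).trans (Finset.card_le_two)
  omega

variable {n : ℕ}

open scoped Classical in
theorem weilOn_pow_two_mul (hK : Fintype.card K = q ^ 2)
    (H : Subgroup (Matrix (Fin n) (Fin n) K)ˣ) (a : ℕ) (g : H) :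
    weilOn q false H g ^ (2 * a) = ∑ u : Fin a → Fin n → K,
      if ∀ k, Matrix.mulVec (g.1 : Matrix (Fin n) (Fin n) K) (u k) = u k then (1 : ℂ) else 0 := by
  have hcard : (Finset.univ.filter fun u : Fin a → Fin n → K =>
      ∀ k, Matrix.mulVec (g.1 : Matrix (Fin n) (Fin n) K) (u k) = u k).card
      = (q ^ 2) ^ (fixedDim g.1 * a) := by
    rw [← hK, pow_mul, fixedDim, ← Module.card_eq_pow_finrank, ← Fintype.card_subtype]
    conv_rhs => rw [← Fintype.card_fin a, ← Fintype.card_fun]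
    refine Fintype.card_congr ((Equiv.subtypePiEquivPi (p := fun (_ : Fin a) (w : Fin n → K) =>
      Matrix.mulVec (g.1 : Matrix (Fin n) (Fin n) K) w = w)).trans
        (Equiv.piCongrRight fun _ => Equiv.subtypeEquivRight fun w => ?_))
    rw [LinearMap.mem_ker, Matrix.mulVecLin_apply, Matrix.sub_mulVec, Matrix.one_mulVec,
      sub_eq_zero]
  rw [Finset.sum_boole, hcard, weilOn_eq, pow_mul, mul_pow, ← pow_mul, mul_comm n 2, pow_mul,
    ← pow_mul (-q : ℂ), mul_comm (fixedDim _) 2, pow_mul (-q : ℂ), pow_mul ((q : ℕ) ^ 2)]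
  simp

open scoped Classical in
/-- The Weil character sums to zero over the unitary maps with prescribed values on fewer than
`n / 2` vectors: right multiplication by the reflections along a vector orthogonal to them
permutes these maps. -/
theorem sum_weilOn_of_mulVec_eq (hK : Fintype.card K = q ^ 2)
    [Fintype (GU n q K hK)] {ι : Type*} [Fintype ι]
    (w w' : ι → Fin n → K) (hι : 2 * Fintype.card ι < n) :
    ∑ g : GU n q K hK,
      (if ∀ k, Matrix.mulVec (g.1 : Matrix (Fin n) (Fin n) K) (w k) = w' k
        then weilOn q false (GU n q K hK) g else 0) = 0 := by
  let _ := frobStarRing q K hK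
  obtain ⟨v, hvw, hv⟩ := exists_star_self_ne_zero (exists_pow_ne_self hK) w hι
  have hμ : (Finset.univ.filter fun a : K => star a * a = 1).card = q + 1 :=
    card_pow_mul_self_eq_one hK
  have hunit : ∀ a : K, star a * a = 1 → ∃ l : GU n q K hK,
      ((l.1 : (Matrix (Fin n) (Fin n) K)ˣ) : Matrix (Fin n) (Fin n) K)
        = unitaryReflection v a := by
    intro a ha
    have h := unitaryReflection_conjTranspose_mul hv ha
    exact ⟨⟨⟨unitaryReflection v a, _, mul_eq_one_comm.1 h, h⟩, h⟩, rfl⟩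
  have hinv : ∀ a : K, star a * a = 1 → ∑ g : GU n q K hK,
      (if ∀ k, Matrix.mulVec (g.1 : Matrix (Fin n) (Fin n) K) (w k) = w' k
        then weilOn q false (GU n q K hK) g else 0)
      = ∑ g : GU n q K hK,
      (if ∀ k, Matrix.mulVec (g.1 : Matrix (Fin n) (Fin n) K) (w k) = w' k
        then (-1) ^ n * (-q : ℂ) ^ Module.finrank K (LinearMap.ker
          ((g.1 : Matrix (Fin n) (Fin n) K) * unitaryReflection v a - 1).mulVecLin)
        else 0) := by
    intro a ha
    obtain ⟨l, hl⟩ := hunit a ha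
    rw [← Equiv.sum_comp (Equiv.mulRight l)]
    refine Finset.sum_congr rfl fun g _ => ?_
    have hfix : ∀ k, Matrix.mulVec (unitaryReflection v a) (w k) = w k := by
      intro k
      rw [unitaryReflection_mulVec, hvw k, mul_zero, zero_smul, add_zero]
    have hgl : (((g * l).1 : (Matrix (Fin n) (Fin n) K)ˣ) : Matrix (Fin n) (Fin n) K)
        = g.1 * unitaryReflection v a := by
      rw [Subgroup.coe_mul, Units.val_mul, hl]
    refine if_congr (forall_congr' fun k => ?_) ?_ rfl
    · rw [Equiv.coe_mulRight, hgl, ← Matrix.mulVec_mulVec, hfix]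
    · rw [Equiv.coe_mulRight, weilOn_eq, fixedDim, hgl]
  have htot : ((q : ℂ) + 1) * ∑ g : GU n q K hK,
      (if ∀ k, Matrix.mulVec (g.1 : Matrix (Fin n) (Fin n) K) (w k) = w' k
        then weilOn q false (GU n q K hK) g else 0) = 0 := by
    have hcast : ((q : ℂ) + 1) = ((Finset.univ.filter fun a : K => star a * a = 1).card : ℂ) := by
      rw [hμ]; push_cast; rfl
    rw [hcast, ← nsmul_eq_mul, ← Finset.sum_const,
      Finset.sum_congr rfl fun a ha => hinv a (Finset.mem_filter.1 ha).2, Finset.sum_comm]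
    refine Finset.sum_eq_zero fun g _ => ?_
    split_ifs
    · rw [← Finset.mul_sum, sum_neg_pow_finrank_fixed_mul_reflection hμ g.2 hv, mul_zero]
    · simp
  exact (mul_eq_zero.1 htot).resolve_left (by exact_mod_cast q.succ_ne_zero)

open scoped Classical in
theorem sum_weilOn_pow_of_mulVec_eq (hK : Fintype.card K = q ^ 2)
    [Fintype (GU n q K hK)] {a b : ℕ}
    (hab : (2 * a + 1) + 2 * b ≤ n) (w w' : Fin b → Fin n → K) :
    ∑ g : GU n q K hK,
      (if ∀ k, Matrix.mulVec (g.1 : Matrix (Fin n) (Fin n) K) (w k) = w' k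
        then weilOn q false (GU n q K hK) g ^ (2 * a + 1) else 0) = 0 := by
  have hexp : ∀ g : GU n q K hK,
      (if ∀ k, Matrix.mulVec (g.1 : Matrix (Fin n) (Fin n) K) (w k) = w' k
        then weilOn q false (GU n q K hK) g ^ (2 * a + 1) else 0)
      = ∑ u : Fin a → Fin n → K,
        if ∀ k : Fin b ⊕ Fin a,
          Matrix.mulVec (g.1 : Matrix (Fin n) (Fin n) K) (Sum.elim w u k) = Sum.elim w' u k
        then weilOn q false (GU n q K hK) g else 0 := by
    intro g
    rw [pow_succ, weilOn_pow_two_mul hK, Finset.sum_mul]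
    simp only [Sum.forall, Sum.elim_inl, Sum.elim_inr, ite_mul, one_mul, zero_mul, ite_and]
    split_ifs
    · rfl
    · simp
  rw [Finset.sum_congr rfl fun g _ => hexp g, Finset.sum_comm]
  refine Finset.sum_eq_zero fun u _ => sum_weilOn_of_mulVec_eq hK _ _ ?_
  rw [Fintype.card_sum, Fintype.card_fin, Fintype.card_fin]
  omega

end FiniteUnitary

section Representation

open CategoryTheory

variable {G : Type} [Group G]

theorem FDRep.exists_eq_smul_one_of_commute (V : FDRep ℂ G) [Simple V] (A : V →ₗ[ℂ] V)
    (hA : ∀ g, A * V.ρ g = V.ρ g * A) : ∃ c : ℂ, A = c • (1 : V →ₗ[ℂ] V) := by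
  let φ : V ⟶ V :=
    { hom := FGModuleCat.ofHom A
      comm := fun g => by
        ext x
        exact LinearMap.congr_fun (hA g) x }
  obtain ⟨c, hc⟩ := endomorphism_simple_eq_smul_id ℂ φ
  refine ⟨c, ?_⟩
  have h := congrArg (fun ψ : V ⟶ V => ψ.hom.hom.hom) hc
  exact h.symm

/-- If `f` sums to zero over all left translates of `P` and `χ` has nonzero sum over `P`, then the
class function `f` is orthogonal to the irreducible character `χ`. -/
theorem sum_mul_character_eq_zero [Fintype G] (V : FDRep ℂ G) [Simple V] {f : G → ℂ}
    (hf : ∀ h g, f (h * g * h⁻¹) = f g) (P : G → Prop) [DecidablePred P]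
    (hP : ∑ h, (if P h then V.character h else 0) ≠ 0)
    (hfP : ∀ h, ∑ g, (if P (g⁻¹ * h) then f g else 0) = 0) :
    ∑ g, f g * V.character g = 0 := by
  let A : V →ₗ[ℂ] V := ∑ g, f g • V.ρ g
  let e : V →ₗ[ℂ] V := ∑ h, if P h then V.ρ h else 0
  have hcomm : ∀ g, A * V.ρ g = V.ρ g * A := by
    intro g
    simp only [A, Finset.sum_mul, Finset.mul_sum]
    rw [← Equiv.sum_comp (MulAut.conj g).toEquiv]
    refine Finset.sum_congr rfl fun x _ => ?_
    change f (g * x * g⁻¹) • V.ρ (g * x * g⁻¹) * V.ρ g = _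
    rw [hf, smul_mul_assoc, ← map_mul, inv_mul_cancel_right, map_mul, mul_smul_comm]
  have hAe : A * e = 0 := by
    simp only [A, e, Finset.sum_mul, Finset.mul_sum]
    have : ∀ g, ∑ h, f g • V.ρ g * (if P h then V.ρ h else 0)
        = ∑ h, (if P (g⁻¹ * h) then f g else 0) • V.ρ h := by
      intro g
      rw [← Equiv.sum_comp (Equiv.mulLeft g⁻¹)]
      refine Finset.sum_congr rfl fun h _ => ?_
      by_cases hp : P (g⁻¹ * h)
      · rw [Equiv.coe_mulLeft, if_pos hp, if_pos hp, smul_mul_assoc, ← map_mul,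
          mul_inv_cancel_left]
      · rw [Equiv.coe_mulLeft, if_neg hp, if_neg hp, mul_zero, zero_smul]
    rw [Finset.sum_comm, Finset.sum_congr rfl fun g _ => this g, Finset.sum_comm]
    refine Finset.sum_eq_zero fun h _ => ?_
    rw [← Finset.sum_smul, hfP, zero_smul]
  have htre : LinearMap.trace ℂ V e ≠ 0 := by
    convert hP using 1
    simp only [e, map_sum, FDRep.character]
    refine Finset.sum_congr rfl fun h _ => ?_
    split_ifs <;> simp
  have htrA : LinearMap.trace ℂ V A = ∑ g, f g * V.character g := by
    simp only [A, map_sum, map_smul, FDRep.character, smul_eq_mul]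
  obtain ⟨c, hc⟩ := V.exists_eq_smul_one_of_commute A hcomm
  have hc0 : c = 0 := by
    by_contra hc0
    apply htre
    rw [hc, smul_mul_assoc, one_mul] at hAe
    rw [(smul_eq_zero.1 hAe).resolve_left hc0, map_zero]
  rw [← htrA, hc, hc0, zero_smul, map_zero]

theorem sum_mul_ne_zero_of_charInner_ne_zero [Fintype G] {f χ : G → ℂ}
    (hf : ∀ g, (starRingEnd ℂ) (f g) = f g) (h : charInner G f χ ≠ 0) :
    ∑ g, f g * χ g ≠ 0 := by
  intro h0
  apply h
  have := congrArg (starRingEnd ℂ) h0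
  rw [map_sum, map_zero] at this
  simp only [map_mul, hf] at this
  rw [charInner, finsum_eq_sum_of_fintype, this, mul_zero]

end Representation

theorem no_common_constituent {n q : ℕ} {K : Type} [Field K] [Fintype K]
    (hK : Fintype.card K = q ^ 2) {i j : ℕ} (hij : i + j ≤ n) (hi : Odd i) (hj : Even j)
    {χ : GU n q K hK → ℂ} (hχ : IsIrrChar _ χ)
    (h1 : charInner _ (weilOn q false (GU n q K hK) ^ i) χ ≠ 0)
    (h2 : charInner _ (weilOn q false (GU n q K hK) ^ j) χ ≠ 0) : False := by
  classical
  obtain ⟨a, rfl⟩ := hi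
  obtain ⟨b, rfl⟩ := even_iff_two_dvd.1 hj
  obtain ⟨V, hV, rfl⟩ := hχ
  have : Fintype (GU n q K hK) := Fintype.ofFinite _
  have hreal : ∀ (m : ℕ) (g : GU n q K hK),
      (starRingEnd ℂ) ((weilOn q false (GU n q K hK) ^ m) g)
        = (weilOn q false (GU n q K hK) ^ m) g := by
    intro m g
    rw [Pi.pow_apply, map_pow, star_weilOn]
  replace h1 := sum_mul_ne_zero_of_charInner_ne_zero (hreal _) h1
  replace h2 := sum_mul_ne_zero_of_charInner_ne_zero (hreal _) h2
  simp only [Pi.pow_apply, weilOn_pow_two_mul hK, Finset.sum_mul, ite_mul, one_mul,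
    zero_mul] at h2
  rw [Finset.sum_comm] at h2
  obtain ⟨w, -, hw⟩ := Finset.exists_ne_zero_of_sum_ne_zero h2
  refine h1 (sum_mul_character_eq_zero V (fun h g => ?_) _ hw fun h => ?_)
  · rw [Pi.pow_apply, Pi.pow_apply, weilOn_conj]
  · refine Eq.trans (Finset.sum_congr rfl fun g _ => ?_) (sum_weilOn_pow_of_mulVec_eq hK hij w
      fun k => Matrix.mulVec (h.1 : Matrix (Fin n) (Fin n) K) (w k))
    refine if_congr (forall_congr' fun k => ?_) rfl rfl
    rw [Subgroup.coe_mul, Units.val_mul, ← Matrix.mulVec_mulVec]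
    constructor
    · intro hk
      have hg := congrArg (Matrix.mulVec (g.1 : Matrix (Fin n) (Fin n) K)) hk
      rw [Matrix.mulVec_mulVec, ← Units.val_mul, ← Subgroup.coe_mul, mul_inv_cancel] at hg
      simpa using hg.symm
    · intro hk
      rw [← hk, Matrix.mulVec_mulVec, ← Units.val_mul, ← Subgroup.coe_mul, inv_mul_cancel]
      simp

/-- parity phenomenon for `GU_n(q)`: if `i + j ≤ n` is odd, then
`(ζ_n)^i` and `(ζ_n)^j` have no common irreducible constituent; in particular, for
`j ≤ n/2` every irreducible constituent of `(ζ_n)^j` has true level `j - 2t`. -/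
theorem character_levels_stmt19 (n q : ℕ) (hn : 1 ≤ n)
    (K : Type) [Field K] [Fintype K] (hK : Fintype.card K = q ^ 2) :
    (∀ i j : ℕ, i + j ≤ n → (i + j) % 2 = 1 →
      ∀ χ : ↥(GU n q K hK) → ℂ, IsIrrChar _ χ →
        ¬(charInner ↥(GU n q K hK) (weilOn q false (GU n q K hK) ^ i) χ ≠ 0 ∧
          charInner ↥(GU n q K hK) (weilOn q false (GU n q K hK) ^ j) χ ≠ 0)) ∧
    (∀ j : ℕ, 2 * j ≤ n →
      ∀ χ : ↥(GU n q K hK) → ℂ, IsIrrChar _ χ →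
        charInner ↥(GU n q K hK) (weilOn q false (GU n q K hK) ^ j) χ ≠ 0 →
        ∃ t : ℕ, 2 * t ≤ j ∧ trueLevel q false (GU n q K hK) χ = j - 2 * t) := by
  have hodd : ∀ i j : ℕ, i + j ≤ n → (i + j) % 2 = 1 →
      ∀ χ : ↥(GU n q K hK) → ℂ, IsIrrChar _ χ →
        ¬(charInner ↥(GU n q K hK) (weilOn q false (GU n q K hK) ^ i) χ ≠ 0 ∧
          charInner ↥(GU n q K hK) (weilOn q false (GU n q K hK) ^ j) χ ≠ 0) := by
    rintro i j hij hpar χ hχ ⟨h1, h2⟩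
    rcases Nat.even_or_odd i with hi | hi
    · have hj : Odd j := by grind
      exact no_common_constituent hK (by omega) hj hi hχ h2 h1
    · have hj : Even j := by grind
      exact no_common_constituent hK hij hi hj hχ h1 h2
  refine ⟨hodd, fun j hj χ hχ h => ?_⟩
  have hmem : charInner ↥(GU n q K hK)
      (weilOn q false (GU n q K hK) ^ trueLevel q false (GU n q K hK) χ) χ ≠ 0 :=
    Nat.sInf_mem (s := {j : ℕ | charInner ↥(GU n q K hK)
      (weilOn q false (GU n q K hK) ^ j) χ ≠ 0}) ⟨j, h⟩
  have hle : trueLevel q false (GU n q K hK) χ ≤ j := Nat.sInf_le h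
  have hpar : (trueLevel q false (GU n q K hK) χ + j) % 2 ≠ 1 := fun hp =>
    hodd _ _ (by omega) hp χ hχ ⟨hmem, h⟩
  exact ⟨(j - trueLevel q false (GU n q K hK) χ) / 2, by omega, by omega⟩
end
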